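/- arXiv:1905.05978 — 2 statements merged into one kernel-verified Lean document; each statement's English description precedes it below -/
import Mathlib

section
/- For N sufficiently large, any ε_N ∈ [(log log N)^{-1/10}, 1), and any δ ∈ (0,1): with ℙ_{p*}-probability at least ε_N/2, the random set {x ∈ Σ_N : ω_x = 1} contains a subset which is a (1−δ)-boosting set at parameter p* of cardinality k ≤ exp(10^{15} (δ ε_N)^{-2} (log log N)^{1/5}). -/
open scoped Classical

noncomputable section

/-- A point of the discrete cube `Σ_N = {-1,1}^N`, encoded by booleans
(`true ↦ +1`, `false ↦ -1`). -/
abbrev Cube (N : ℕ) := Fin N → Bool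

/-- The `±1` value encoded by a boolean. -/
def pmVal (b : Bool) : ℝ := if b then 1 else -1

/-- The inner product `x · y = ∑ i x^i y^i` on `Σ_N`. -/
def cubeDot {N : ℕ} (x y : Cube N) : ℝ := ∑ i, pmVal (x i) * pmVal (y i)

/-- The half cube `H(x) := {y ∈ Σ_N : x · y ≥ κ √N}`. -/
def halfCube {N : ℕ} (κ : ℝ) (x : Cube N) : Set (Cube N) :=
  {y | cubeDot x y ≥ κ * Real.sqrt N}

/-- Bernoulli(p) product weight of a configuration `ω : Σ_N → {0,1}`. -/
def bWeight {N : ℕ} (p : ℝ) (ω : Cube N → Bool) : ℝ :=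
  p ^ (Finset.univ.filter fun x => ω x = true).card *
    (1 - p) ^ (Finset.univ.filter fun x => ω x = false).card

/-- The product Bernoulli measure `ℙ_p` of an event `E ⊆ {0,1}^{Σ_N}`. -/
def bernoulliP {N : ℕ} (p : ℝ) (E : Set (Cube N → Bool)) : ℝ :=
  ∑ ω : Cube N → Bool, if ω ∈ E then bWeight p ω else 0

/-- The event `E = {⋂_{x : ω_x = 1} H(x) = ∅}`. -/
def emptyInter {N : ℕ} (κ : ℝ) : Set (Cube N → Bool) :=
  {ω | (⋂ x ∈ {x : Cube N | ω x = true}, halfCube κ x) = (∅ : Set (Cube N))}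

/-- The total influence `I(p)` of the indicator of the event `E` as a boolean
function of `(ω_x)_{x ∈ Σ_N}`: `I(p) = ∑_x ℙ_p(1_E(ω) ≠ 1_E(ω^{(x)}))`, where
`ω^{(x)}` resamples coordinate `x` independently. -/
def influence {N : ℕ} (κ p : ℝ) : ℝ :=
  ∑ x : Cube N, ∑ ω : Cube N → Bool, ∑ b : Bool,
    bWeight p ω * (if b then p else 1 - p) *
      (if (ω ∈ emptyInter κ ↔ Function.update ω x b ∈ emptyInter κ) then 0 else 1)

/-- `p* := inf {p ≥ p_N(ε_N) : I(p) ≤ 8 (log log N)^{1/10}}`. -/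
def pStar {N : ℕ} (κ pN : ℝ) : ℝ :=
  sInf {p : ℝ | pN ≤ p ∧ influence (N := N) κ p ≤ 8 * Real.log (Real.log N) ^ ((1 : ℝ) / 10)}
/-- A finite set T ⊆ Σ_N is a (1-δ)-boosting set at parameter p if
ℙ_p(⋂_{x : ω_x = 1} H(x) ∩ ⋂_{x ∈ T} H(x) = ∅) ≥ 1 - δ. -/
def PerceptronBoosting {N : ℕ} (κ p δ : ℝ) (T : Finset (Cube N)) : Prop :=
  bernoulliP p
      {ω : Cube N → Bool |
        ((⋂ x ∈ {x : Cube N | ω x = true}, halfCube κ x) ∩ ⋂ x ∈ T, halfCube κ x) =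
          (∅ : Set (Cube N))} ≥ 1 - δ

set_option linter.unusedSectionVars false
set_option linter.unusedVariables false

/-! ### Product expectations -/

def PE {V α : Type*} [Fintype V] [DecidableEq V] [Fintype α] (μ : V → α → ℝ) (F : (V → α) → ℝ) : ℝ :=
  ∑ a : V → α, (∏ x, μ x (a x)) * F a

section PEsec
variable {V α β : Type*} [Fintype V] [DecidableEq V] [Fintype α] [Fintype β]

lemma PE_add (μ : V → α → ℝ) (F G : (V → α) → ℝ) :
    PE μ (fun a => F a + G a) = PE μ F + PE μ G := by
  simp [PE, mul_add, Finset.sum_add_distrib]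

lemma PE_sub (μ : V → α → ℝ) (F G : (V → α) → ℝ) :
    PE μ (fun a => F a - G a) = PE μ F - PE μ G := by
  simp [PE, mul_sub, Finset.sum_sub_distrib]

lemma PE_mul_left (μ : V → α → ℝ) (c : ℝ) (F : (V → α) → ℝ) :
    PE μ (fun a => c * F a) = c * PE μ F := by
  simp only [PE, Finset.mul_sum]
  exact Finset.sum_congr rfl fun a _ => by ring

lemma PE_mul_right (μ : V → α → ℝ) (c : ℝ) (F : (V → α) → ℝ) :
    PE μ (fun a => F a * c) = PE μ F * c := by
  simp only [PE, Finset.sum_mul]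
  exact Finset.sum_congr rfl fun a _ => by ring

lemma PE_sum {ι : Type*} (s : Finset ι) (μ : V → α → ℝ) (F : ι → (V → α) → ℝ) :
    PE μ (fun a => ∑ i ∈ s, F i a) = ∑ i ∈ s, PE μ (F i) := by
  simp only [PE, Finset.mul_sum]
  rw [Finset.sum_comm]

lemma PE_mono {μ : V → α → ℝ} (hμ : ∀ x v, 0 ≤ μ x v) {F G : (V → α) → ℝ} (h : ∀ a, F a ≤ G a) :
    PE μ F ≤ PE μ G := by
  unfold PE
  exact Finset.sum_le_sum fun a _ =>
    mul_le_mul_of_nonneg_left (h a) (Finset.prod_nonneg fun x _ => hμ x _)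

lemma PE_nonneg {μ : V → α → ℝ} (hμ : ∀ x v, 0 ≤ μ x v) {F : (V → α) → ℝ} (h : ∀ a, 0 ≤ F a) :
    0 ≤ PE μ F := by
  unfold PE
  exact Finset.sum_nonneg fun a _ => mul_nonneg (Finset.prod_nonneg fun x _ => hμ x _) (h a)

lemma PE_prod (μ : V → α → ℝ) (g : V → α → ℝ) :
    PE μ (fun a => ∏ x, g x (a x)) = ∏ x, ∑ v, μ x v * g x v := by
  unfold PE
  rw [Finset.prod_univ_sum]
  simp only [← Finset.prod_mul_distrib, Fintype.piFinset_univ]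

lemma PE_one {μ : V → α → ℝ} (h1 : ∀ x, ∑ v, μ x v = 1) : PE μ (fun _ => 1) = 1 := by
  have := PE_prod μ (fun _ _ => 1)
  simp only [Finset.prod_const_one, mul_one, h1] at this
  exact this

lemma PE_const {μ : V → α → ℝ} (h1 : ∀ x, ∑ v, μ x v = 1) (c : ℝ) : PE μ (fun _ => c) = c := by
  have := PE_mul_left μ c (fun _ => 1)
  simpa [PE_one h1] using this

/-- absorb a product into the weight -/
lemma PE_absorb (μ : V → α → ℝ) (S : Finset V) (g : V → α → ℝ) (F : (V → α) → ℝ) :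
    PE μ (fun a => F a * ∏ x ∈ S, g x (a x)) =
      PE (fun x v => μ x v * if x ∈ S then g x v else 1) F := by
  unfold PE
  refine Finset.sum_congr rfl fun a _ => ?_
  rw [Finset.prod_mul_distrib, Finset.prod_ite_mem]
  simp
  ring

lemma PE_push (μ : V → α → ℝ) (π : V → α → β) (F : (V → β) → ℝ) :
    PE μ (fun a => F (fun x => π x (a x))) =
      PE (fun x b => ∑ v ∈ Finset.univ.filter (fun v => π x v = b), μ x v) F := by
  unfold PE
  rw [← Finset.sum_fiberwise_of_maps_to (s := (Finset.univ : Finset (V → α)))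
    (t := (Finset.univ : Finset (V → β))) (g := fun a x => π x (a x)) (fun _ _ => Finset.mem_univ _)]
  refine Finset.sum_congr rfl fun b _ => ?_
  rw [Finset.prod_univ_sum, Finset.sum_mul]
  have : (Finset.univ.filter fun a : V → α => (fun x => π x (a x)) = b) =
      Fintype.piFinset (fun x => Finset.univ.filter (fun v => π x v = b x)) := by
    ext a
    simp [Fintype.mem_piFinset, funext_iff]
  rw [← this]
  refine Finset.sum_congr rfl fun a ha => ?_
  simp only [Finset.mem_filter] at ha
  have h2 : (fun x => π x (a x)) = b := ha.2
  show _ * F (fun x => π x (a x)) = _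
  rw [h2]

lemma PE_coord {μ : V → α → ℝ} (x : V) (h1 : ∑ v, μ x v = 1) (F : (V → α) → ℝ) :
    PE μ F = PE μ (fun a => ∑ v, μ x v * F (Function.update a x v)) := by
  have key : ∀ (a : V → α) (v : α), (∏ y, μ y (a y)) * μ x v =
      (∏ y, μ y (Function.update a x v y)) * μ x (a x) := by
    intro a v
    rw [← Finset.mul_prod_erase _ _ (Finset.mem_univ x),
      ← Finset.mul_prod_erase _ (fun y => μ y (Function.update a x v y)) (Finset.mem_univ x)]
    have : ∏ y ∈ Finset.univ.erase x, μ y (Function.update a x v y) =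
        ∏ y ∈ Finset.univ.erase x, μ y (a y) := by
      refine Finset.prod_congr rfl fun y hy => ?_
      rw [Function.update_of_ne (Finset.ne_of_mem_erase hy)]
    rw [this, Function.update_self]
    ring
  have h2 : PE μ (fun a => ∑ v, μ x v * F (Function.update a x v)) =
      ∑ q : (V → α) × α, (∏ y, μ y (q.1 y)) * μ x q.2 * F (Function.update q.1 x q.2) := by
    unfold PE
    rw [Fintype.sum_prod_type]
    refine Finset.sum_congr rfl fun a _ => ?_
    rw [Finset.mul_sum]
    refine Finset.sum_congr rfl fun v _ => by ring
  have h3 : PE μ F = ∑ q : (V → α) × α, (∏ y, μ y (q.1 y)) * μ x q.2 * F q.1 := by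
    unfold PE
    rw [Fintype.sum_prod_type]
    refine Finset.sum_congr rfl fun a _ => ?_
    simp only [← Finset.sum_mul, ← Finset.mul_sum, h1, mul_one]
  rw [h2, h3]
  refine Finset.sum_nbij' (fun q => (Function.update q.1 x q.2, q.1 x))
    (fun q => (Function.update q.1 x q.2, q.1 x)) (by simp) (by simp) (by simp) (by simp) ?_
  rintro ⟨a, v⟩ _
  simp only [Function.update_self, Function.update_idem, Function.update_eq_self]
  rw [key a v]

lemma PE_prod_type (μ : V → α → ℝ) (ν : V → β → ℝ) (F : (V → α) → (V → β) → ℝ) :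
    PE (fun x (q : α × β) => μ x q.1 * ν x q.2) (fun a => F (fun x => (a x).1) (fun x => (a x).2)) =
      PE μ (fun a => PE ν (fun b => F a b)) := by
  unfold PE
  simp only [Finset.mul_sum]
  rw [← Fintype.sum_prod_type' (f := fun (a : V → α) (b : V → β) =>
    (∏ x, μ x (a x)) * ((∏ x, ν x (b x)) * F a b))]
  refine Fintype.sum_equiv (Equiv.arrowProdEquivProdArrow V (fun _ => α) (fun _ => β)) _ _ ?_
  intro a
  simp only [Equiv.arrowProdEquivProdArrow, Finset.prod_mul_distrib, Equiv.coe_fn_mk]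
  ring

lemma PE_comm (μ : V → α → ℝ) (ν : V → β → ℝ) (F : (V → α) → (V → β) → ℝ) :
    PE μ (fun a => PE ν (fun b => F a b)) = PE ν (fun b => PE μ (fun a => F a b)) := by
  unfold PE
  simp only [Finset.mul_sum]
  rw [Finset.sum_comm]
  exact Finset.sum_congr rfl fun b _ => Finset.sum_congr rfl fun a _ => by ring

lemma PE_cauchy {μ : V → α → ℝ} (hμ : ∀ x v, 0 ≤ μ x v) (F G : (V → α) → ℝ) :
    (PE μ (fun a => F a * G a)) ^ 2 ≤ PE μ (fun a => F a ^ 2) * PE μ (fun a => G a ^ 2) := by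
  unfold PE
  have h := Finset.sum_mul_sq_le_sq_mul_sq (Finset.univ : Finset (V → α))
    (fun a => Real.sqrt (∏ x, μ x (a x)) * F a) (fun a => Real.sqrt (∏ x, μ x (a x)) * G a)
  have hs : ∀ a : V → α, Real.sqrt (∏ x, μ x (a x)) ^ 2 = ∏ x, μ x (a x) := fun a =>
    Real.sq_sqrt (Finset.prod_nonneg fun x _ => hμ x _)
  have e1 : ∀ a : V → α, Real.sqrt (∏ x, μ x (a x)) * F a * (Real.sqrt (∏ x, μ x (a x)) * G a) =
      (∏ x, μ x (a x)) * (F a * G a) := fun a => by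
    rw [← hs a, Real.sqrt_sq (Real.sqrt_nonneg _)]; ring
  simpa only [e1, mul_pow, hs] using h

end PEsec

/-! ### Bernoulli -/

def bw (p : ℝ) (b : Bool) : ℝ := if b then p else 1 - p

def xi (p : ℝ) (b : Bool) : ℝ := (if b then 1 else 0) - p

def BE {V : Type*} [Fintype V] [DecidableEq V] (p : ℝ) (F : (V → Bool) → ℝ) : ℝ :=
  PE (fun _ => bw p) F

lemma bw_sum (p : ℝ) : ∑ b, bw p b = 1 := by simp [bw]

lemma bw_nonneg {p : ℝ} (h0 : 0 ≤ p) (h1 : p ≤ 1) (b : Bool) : 0 ≤ bw p b := by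
  cases b <;> simp [bw] <;> linarith

def Infl {V : Type*} [Fintype V] [DecidableEq V] (p : ℝ) (f : (V → Bool) → ℝ) : ℝ :=
  ∑ x, BE p (fun ω => ∑ b, bw p b * (f ω - f (Function.update ω x b)) ^ 2)

def FC {V : Type*} [Fintype V] [DecidableEq V] (p : ℝ) (f : (V → Bool) → ℝ) (S : Finset V) : ℝ :=
  BE p (fun ω => f ω * ∏ x ∈ S, xi p (ω x))

section Bsec
variable {V : Type*} [Fintype V] [DecidableEq V]

lemma kernel {p : ℝ} (h0 : 0 < p) (h1 : p < 1) (F : (V → Bool) → ℝ) (J : Finset V) :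
    ∑ S ∈ J.powerset, FC p F S ^ 2 / (p * (1 - p)) ^ S.card =
      BE p (fun r => BE p (fun r' => F r * F (J.piecewise r r'))) := by
  have hp : p ≠ 0 := h0.ne'
  have hq : 1 - p ≠ 0 := by linarith
  have e1 : ∀ S : Finset V, FC p F S ^ 2 / (p * (1 - p)) ^ S.card =
      BE p (fun r => BE p (fun r' => F r * F r' * ∏ x ∈ S, (xi p (r x) * xi p (r' x) / (p * (1 - p))))) := by
    intro S
    have : ∀ r r' : V → Bool, F r * F r' * ∏ x ∈ S, (xi p (r x) * xi p (r' x) / (p * (1 - p))) =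
        (F r * ∏ x ∈ S, xi p (r x)) * ((F r' * ∏ x ∈ S, xi p (r' x)) * (1 / (p * (1 - p)) ^ S.card)) := by
      intro r r'
      rw [Finset.prod_div_distrib, Finset.prod_mul_distrib, Finset.prod_const]
      ring
    simp only [this, BE, PE_mul_left, PE_mul_right]
    simp only [FC, BE]
    ring
  rw [Finset.sum_congr rfl fun S _ => e1 S]
  simp only [BE]
  rw [← PE_sum]
  simp only [← PE_sum, ← Finset.mul_sum, ← Finset.prod_one_add]
  rw [← PE_prod_type (fun _ => bw p) (fun _ => bw p)
    (fun r r' => F r * F r' * ∏ x ∈ J, (1 + xi p (r x) * xi p (r' x) / (p * (1 - p)))),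
    ← PE_prod_type (fun _ => bw p) (fun _ => bw p) (fun r r' => F r * F (J.piecewise r r'))]
  have := PE_absorb (fun (_ : V) (q : Bool × Bool) => bw p q.1 * bw p q.2) J
    (fun _ q => 1 + xi p q.1 * xi p q.2 / (p * (1 - p)))
    (fun a => F (fun x => (a x).1) * F (fun x => (a x).2))
  rw [this]
  have h2 := PE_push (fun (_ : V) (q : Bool × Bool) => bw p q.1 * bw p q.2)
    (fun x q => if x ∈ J then (q.1, q.1) else q)
    (fun a => F (fun x => (a x).1) * F (fun x => (a x).2))
  have e3 : ∀ a : V → Bool × Bool, F (fun x => (if x ∈ J then ((a x).1, (a x).1) else a x).1) *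
      F (fun x => (if x ∈ J then ((a x).1, (a x).1) else a x).2) =
      F (fun x => (a x).1) * F (J.piecewise (fun x => (a x).1) (fun x => (a x).2)) := by
    intro a
    congr 2
    · funext x; split_ifs <;> rfl
    · funext x; by_cases hx : x ∈ J <;> simp [hx, Finset.piecewise]
  simp only [e3] at h2
  rw [h2]
  congr 1
  funext x q
  rcases q with ⟨a, b⟩
  by_cases hx : x ∈ J
  · simp only [hx, if_true]
    rw [Finset.sum_filter, Fintype.sum_prod_type]
    cases a <;> cases b <;> simp [bw, xi] <;> field_simp <;> first | ring1 | (simp; done) | (ring_nf; simp; done)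
  · simp only [hx, if_false]
    rw [Finset.sum_filter, Fintype.sum_prod_type]
    cases a <;> cases b <;> simp [bw]

end Bsec

/-! ### Hypercontractivity and KKL on the uniform cube -/

def sg (b : Bool) : ℝ := if b then 1 else -1

def chi {V : Type*} (S : Finset V) (r : V → Bool) : ℝ := ∏ x ∈ S, sg (r x)

def hc {V : Type*} [Fintype V] [DecidableEq V] (φ : (V → Bool) → ℝ) (S : Finset V) : ℝ :=
  BE (1/2) (fun r => φ r * chi S r)

def flipAt {V : Type*} [DecidableEq V] (u : V) (r : V → Bool) : V → Bool :=
  Function.update r u (!(r u))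

def Iu {V : Type*} [Fintype V] [DecidableEq V] (φ : (V → Bool) → ℝ) (u : V) : ℝ :=
  BE (1/2) (fun r => (φ r - φ (flipAt u r)) ^ 2)

section Csec
variable {V : Type*} [Fintype V] [DecidableEq V]

lemma half_nonneg : ∀ (x : V) (b : Bool), 0 ≤ (fun _ : V => bw (1/2)) x b := fun _ b =>
  bw_nonneg (by norm_num) (by norm_num) b

lemma bw_half (b : Bool) : bw (1/2) b = 1/2 := by cases b <;> simp [bw]; norm_num

lemma chi_update {S : Finset V} {a : V} (h : a ∉ S) (r : V → Bool) (b : Bool) :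
    chi S (Function.update r a b) = chi S r := by
  refine Finset.prod_congr rfl fun x hx => ?_
  rw [Function.update_of_ne (ne_of_mem_of_not_mem hx h)]

lemma chi_insert {S : Finset V} {a : V} (h : a ∉ S) (r : V → Bool) :
    chi (insert a S) r = sg (r a) * chi S r := by
  unfold chi; rw [Finset.prod_insert h]

lemma BE_coord (p : ℝ) (x : V) (F : (V → Bool) → ℝ) :
    BE p F = BE p (fun a => p * F (Function.update a x true) + (1 - p) * F (Function.update a x false)) := by
  unfold BE
  rw [PE_coord x (bw_sum p) F]
  simp [bw]

lemma bonami (U : Finset V) : ∀ c : Finset V → ℝ,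
    BE (1/2) (fun r => (∑ S ∈ U.powerset, c S * chi S r) ^ 4) ≤
      (∑ S ∈ U.powerset, 3 ^ S.card * c S ^ 2) ^ 2 := by
  induction U using Finset.induction_on with
  | empty =>
    intro c
    simp [chi, BE]
    rw [PE_const (fun _ => by simpa using bw_sum (2⁻¹))]
    apply le_of_eq; ring
  | insert a U ha ih =>
    intro c
    have hn : ∀ S ∈ U.powerset, a ∉ S := fun S hS h => ha (Finset.mem_powerset.1 hS h)
    set h0 : (V → Bool) → ℝ := fun r => ∑ S ∈ U.powerset, c S * chi S r with hh0
    set h1 : (V → Bool) → ℝ := fun r => ∑ S ∈ U.powerset, c (insert a S) * chi S r with hh1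
    have e : ∀ r, ∑ S ∈ (insert a U).powerset, c S * chi S r = h0 r + sg (r a) * h1 r := by
      intro r
      rw [Finset.sum_powerset_insert ha, hh0, hh1, Finset.mul_sum]
      congr 1
      refine Finset.sum_congr rfl fun S hS => ?_
      rw [chi_insert (hn S hS)]; ring
    have i0 : ∀ r b, h0 (Function.update r a b) = h0 r := fun r b =>
      Finset.sum_congr rfl fun S hS => by rw [chi_update (hn S hS)]
    have i1 : ∀ r b, h1 (Function.update r a b) = h1 r := fun r b =>
      Finset.sum_congr rfl fun S hS => by rw [chi_update (hn S hS)]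
    have e2 : BE (1/2) (fun r => (∑ S ∈ (insert a U).powerset, c S * chi S r) ^ 4) =
        BE (1/2) (fun r => h0 r ^ 4) + 6 * BE (1/2) (fun r => h0 r ^ 2 * h1 r ^ 2) +
          BE (1/2) (fun r => h1 r ^ 4) := by
      simp only [e]
      rw [BE_coord _ a]
      simp only [i0, i1, Function.update_self, BE]
      rw [← PE_mul_left, ← PE_add, ← PE_add]
      congr 1; funext r; simp [sg]; ring
    rw [e2]
    have b0 := ih c
    have b1 := ih (fun S => c (insert a S))
    rw [Finset.sum_powerset_insert ha]
    set P := ∑ S ∈ U.powerset, 3 ^ S.card * c S ^ 2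
    set Q := ∑ S ∈ U.powerset, 3 ^ S.card * c (insert a S) ^ 2
    have hP : 0 ≤ P := Finset.sum_nonneg fun S _ => by positivity
    have hQ : 0 ≤ Q := Finset.sum_nonneg fun S _ => by positivity
    have e3 : ∑ S ∈ U.powerset, (3:ℝ) ^ (insert a S).card * c (insert a S) ^ 2 = 3 * Q := by
      rw [Finset.mul_sum]
      refine Finset.sum_congr rfl fun S hS => ?_
      rw [Finset.card_insert_of_notMem (hn S hS)]; ring
    rw [e3]
    have cs := PE_cauchy (μ := fun _ : V => bw (1/2)) half_nonneg (fun r => h0 r ^ 2) (fun r => h1 r ^ 2)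
    simp only [← pow_mul] at cs
    change (BE (1/2) (fun r => h0 r ^ 2 * h1 r ^ 2))^2 ≤ BE (1/2) (fun r => h0 r ^ 4) * BE (1/2) (fun r => h1 r ^ 4) at cs
    have n0 : 0 ≤ BE (1/2) (fun r => h0 r ^ 4) := PE_nonneg half_nonneg (fun r => by positivity)
    have n1 : 0 ≤ BE (1/2) (fun r => h1 r ^ 4) := PE_nonneg half_nonneg (fun r => by positivity)
    have c2 : (BE (1/2) (fun r => h0 r ^ 2 * h1 r ^ 2))^2 ≤ (P * Q)^2 := by
      rw [mul_pow]
      exact cs.trans (mul_le_mul b0 b1 n1 (by positivity))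
    have c3 := abs_le_of_sq_le_sq' c2 (by positivity)
    have c4 := c3.2
    nlinarith [mul_nonneg hP hQ, sq_nonneg Q]

lemma BE_flip (u : V) (F : (V → Bool) → ℝ) :
    BE (1/2) (fun r => F (flipAt u r)) = BE (1/2) F := by
  rw [BE_coord _ u, BE_coord _ u F]
  unfold flipAt
  simp only [Function.update_self, Function.update_idem, Bool.not_true, Bool.not_false]
  congr 1; funext r; ring

lemma flip_chi {S : Finset V} {u : V} (h : u ∈ S) (r : V → Bool) :
    chi S (flipAt u r) = - chi S r := by
  have : S = insert u (S.erase u) := (Finset.insert_erase h).symm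
  rw [this, chi_insert (by simp), chi_insert (by simp)]
  unfold flipAt
  rw [chi_update (by simp), Function.update_self]
  cases r u <;> simp [sg]

lemma hc_sq (φ : (V → Bool) → ℝ) (S : Finset V) :
    hc φ S ^ 2 = FC (1/2) φ S ^ 2 / ((1/2) * (1 - 1/2)) ^ S.card := by
  have : hc φ S = 2 ^ S.card * FC (1/2) φ S := by
    unfold hc FC BE
    rw [← PE_mul_left]
    congr 1; funext r
    unfold chi
    rw [← Finset.prod_const, mul_left_comm, ← Finset.prod_mul_distrib]
    congr 1
    refine Finset.prod_congr rfl fun x _ => ?_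
    cases r x <;> simp [sg, xi] <;> norm_num
  rw [this, mul_pow, ← pow_mul, mul_comm S.card 2, pow_mul]
  norm_num
  field_simp
  rw [mul_right_comm, ← mul_pow]; norm_num

lemma parseval {p : ℝ} (h0 : 0 < p) (h1 : p < 1) (F : (V → Bool) → ℝ) :
    ∑ S : Finset V, FC p F S ^ 2 / (p * (1 - p)) ^ S.card = BE p (fun r => F r ^ 2) := by
  have := kernel h0 h1 F Finset.univ
  simp only [Finset.powerset_univ, Finset.piecewise_univ] at this
  rw [this]
  unfold BE
  congr 1; funext r
  rw [PE_const (fun _ => bw_sum p)]; ring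

lemma BE_le_one {p : ℝ} (h0 : 0 ≤ p) (h1 : p ≤ 1) {F : (V → Bool) → ℝ} (h : ∀ r, F r ≤ 1) : BE p F ≤ 1 := by
  have := PE_mono (μ := fun _ : V => bw p) (fun _ b => bw_nonneg h0 h1 b) h
  rwa [PE_const (fun _ => bw_sum p)] at this

lemma hc_sum_le {φ : (V → Bool) → ℝ} (h : ∀ r, φ r = 0 ∨ φ r = 1) : ∑ S : Finset V, hc φ S ^ 2 ≤ 1 := by
  simp only [hc_sq]
  rw [parseval (by norm_num) (by norm_num)]
  refine BE_le_one (by norm_num) (by norm_num) fun r => ?_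
  rcases h r with h | h <;> rw [h] <;> norm_num

lemma Iu_nonneg (φ : (V → Bool) → ℝ) (u : V) : 0 ≤ Iu φ u :=
  PE_nonneg half_nonneg fun r => by positivity

lemma kkl_coord {φ : (V → Bool) → ℝ} (h : ∀ r, φ r = 0 ∨ φ r = 1) (u : V) (k : ℕ) {s : ℝ} (hs : 0 ≤ s)
    (hu : Iu φ u ≤ s ^ 2) :
    ∑ S : Finset V, (if u ∈ S ∧ S.card ≤ k then hc φ S ^ 2 else 0) ≤ 3 ^ k * s * Iu φ u / 4 := by
  set Q := ∑ S : Finset V, (if u ∈ S ∧ S.card ≤ k then hc φ S ^ 2 else 0) with hQ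
  set c : Finset V → ℝ := fun S => if u ∈ S ∧ S.card ≤ k then hc φ S else 0 with hc'
  set X : (V → Bool) → ℝ := fun r => ∑ S : Finset V, c S * chi S r with hX
  set d : (V → Bool) → ℝ := fun r => φ r - φ (flipAt u r) with hd
  have hQ0 : 0 ≤ Q := Finset.sum_nonneg fun S _ => by split_ifs <;> positivity
  have e1 : BE (1/2) (fun r => φ r * X r) = Q := by
    simp only [hX, Finset.mul_sum]
    unfold BE
    rw [PE_sum, hQ]
    refine Finset.sum_congr rfl fun S _ => ?_
    have : ∀ r, φ r * (c S * chi S r) = c S * (φ r * chi S r) := fun r => by ring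
    simp only [this, PE_mul_left]
    change c S * hc φ S = _
    simp only [hc']
    split_ifs <;> ring
  have e2 : ∀ r, X (flipAt u r) = - X r := by
    intro r
    simp only [hX, ← Finset.sum_neg_distrib]
    refine Finset.sum_congr rfl fun S _ => ?_
    simp only [hc']
    split_ifs with hS
    · rw [flip_chi hS.1]; ring
    · ring
  have e3 : BE (1/2) (fun r => d r * X r) = 2 * Q := by
    have := BE_flip u (fun r => φ r * X r)
    simp only [e2] at this
    have e : (fun r => d r * X r) = fun r => φ r * X r + φ (flipAt u r) * (- X r) := by
      funext r; simp only [hd]; ring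
    rw [e]
    unfold BE at this e1 ⊢
    rw [PE_add, this, e1]; ring
  have hd3 : ∀ r, d r ^ 3 = d r := by
    intro r; simp only [hd]
    rcases h r with a | a <;> rcases h (flipAt u r) with b | b <;> rw [a, b] <;> norm_num
  have cs1 := PE_cauchy (μ := fun _ : V => bw (1/2)) half_nonneg d (fun r => d r ^ 2 * X r)
  have cs2 := PE_cauchy (μ := fun _ : V => bw (1/2)) half_nonneg (fun r => d r ^ 2) (fun r => X r ^ 2)
  have f1 : ∀ r, d r * (d r ^ 2 * X r) = d r * X r := fun r => by
    rw [← mul_assoc, show d r * d r ^ 2 = d r ^ 3 by ring, hd3]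
  have f2 : ∀ r, (d r ^ 2 * X r) ^ 2 = d r ^ 2 * X r ^ 2 := fun r => by
    rw [mul_pow, show (d r ^ 2)^2 = d r ^ 3 * d r by ring, hd3]; ring
  have f3 : ∀ r, (d r ^ 2) ^ 2 = d r ^ 2 := fun r => by
    rw [show (d r ^ 2)^2 = d r ^ 3 * d r by ring, hd3]; ring
  simp only [f1, f2, f3, ← pow_mul] at cs1 cs2
  change (BE (1/2) (fun r => d r * X r))^2 ≤ Iu φ u * BE (1/2) (fun r => d r ^ 2 * X r ^ 2) at cs1
  change (BE (1/2) (fun r => d r ^ 2 * X r ^ 2))^2 ≤ Iu φ u * BE (1/2) (fun r => X r ^ 4) at cs2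
  rw [e3] at cs1
  have hb : BE (1/2) (fun r => X r ^ 4) ≤ (3 ^ k * Q) ^ 2 := by
    have := bonami (Finset.univ : Finset V) c
    simp only [Finset.powerset_univ] at this
    refine this.trans ?_
    refine pow_le_pow_left₀ (Finset.sum_nonneg fun S _ => by positivity) ?_ 2
    rw [hQ, Finset.mul_sum]
    refine Finset.sum_le_sum fun S _ => ?_
    simp only [hc']
    split_ifs with hS
    · exact mul_le_mul_of_nonneg_right (pow_le_pow_right₀ (by norm_num) hS.2) (by positivity)
    · simp
  have hI := Iu_nonneg φ u
  set I := Iu φ u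
  set Y := BE (1/2) (fun r => d r ^ 2 * X r ^ 2)
  have hY : 0 ≤ Y := PE_nonneg half_nonneg fun r => by positivity
  have g1 : Y ^ 2 ≤ (s * (3 ^ k * Q)) ^ 2 := by
    rw [mul_pow]
    exact cs2.trans (mul_le_mul hu hb (PE_nonneg half_nonneg fun r => by positivity) (by positivity))
  have g2 : Y ≤ s * (3 ^ k * Q) := (abs_le_of_sq_le_sq' g1 (by positivity)).2
  have g3 : (2 * Q) ^ 2 ≤ I * (s * (3 ^ k * Q)) := cs1.trans (mul_le_mul_of_nonneg_left g2 hI)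
  rcases hQ0.eq_or_lt with h0 | h0
  · rw [← h0]; positivity
  · have : Q * (4 * Q) ≤ Q * (3 ^ k * s * I) := by nlinarith
    have := le_of_mul_le_mul_left this h0
    linarith

lemma card_small (B : Finset V) (k : ℕ) :
    (Finset.univ.filter fun S : Finset V => S ⊆ B ∧ S.card ≤ k).card ≤ (B.card + 1) ^ k := by
  induction k with
  | zero =>
    simp only [pow_zero, Nat.le_zero, Finset.card_eq_zero]
    refine Finset.card_le_one.2 ?_
    intro a ha b hb
    simp at ha hb
    rw [ha.2, hb.2]
  | succ k ih =>
    set P := Finset.univ.filter fun S : Finset V => S ⊆ B ∧ S.card ≤ k with hP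
    have : (Finset.univ.filter fun S : Finset V => S ⊆ B ∧ S.card ≤ k + 1) ⊆
        P ∪ (B ×ˢ P).image (fun q => insert q.1 q.2) := by
      intro S hS
      simp only [Finset.mem_filter, Finset.mem_univ, true_and] at hS
      rcases Nat.lt_or_ge k S.card with h | h
      · obtain ⟨a, ha⟩ : S.Nonempty := Finset.card_pos.1 (by omega)
        refine Finset.mem_union_right _ (Finset.mem_image.2 ⟨(a, S.erase a), ?_, Finset.insert_erase ha⟩)
        simp only [Finset.mem_product, hP, Finset.mem_filter, Finset.mem_univ, true_and]
        refine ⟨hS.1 ha, (Finset.erase_subset _ _).trans hS.1, ?_⟩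
        rw [Finset.card_erase_of_mem ha]; omega
      · exact Finset.mem_union_left _ (by simp [hP, hS.1, h])
    refine (Finset.card_le_card this).trans ((Finset.card_union_le _ _).trans ?_)
    refine (Nat.add_le_add_left Finset.card_image_le _).trans ?_
    rw [Finset.card_product, pow_succ]
    nlinarith

lemma kkl_cube {φ : (V → Bool) → ℝ} (h : ∀ r, φ r = 0 ∨ φ r = 1) (k : ℕ) {s τ A : ℝ} (hs : 0 < s)
    (hτ : 0 ≤ τ) (hA : 0 < A) :
    ∑ S : Finset V, (if S.card ≤ k ∧ hc φ S ^ 2 < τ then hc φ S ^ 2 else 0) ≤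
      3 ^ k * s * (∑ u, Iu φ u) / 4 + τ * (A + 1) ^ k + (∑ u, Iu φ u) / (s ^ 2 * A) := by
  set I := ∑ u, Iu φ u with hI
  have hI0 : 0 ≤ I := Finset.sum_nonneg fun u _ => Iu_nonneg φ u
  set B := Finset.univ.filter fun u => s ^ 2 ≤ Iu φ u with hB
  have hBc : (B.card : ℝ) * s ^ 2 ≤ I := by
    have h1 : ∑ u ∈ B, s ^ 2 ≤ ∑ u ∈ B, Iu φ u := Finset.sum_le_sum fun u hu => by
      simpa [hB] using hu
    have h2 : ∑ u ∈ B, Iu φ u ≤ I := Finset.sum_le_sum_of_subset_of_nonneg (Finset.subset_univ _)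
      fun u _ _ => Iu_nonneg φ u
    rw [Finset.sum_const, nsmul_eq_mul] at h1
    linarith
  rcases le_or_gt (B.card : ℝ) A with hc1 | hc1
  · have m1 : ∀ S : Finset V, (if S.card ≤ k ∧ hc φ S ^ 2 < τ then hc φ S ^ 2 else 0) ≤
        (∑ u ∈ Bᶜ, if u ∈ S ∧ S.card ≤ k then hc φ S ^ 2 else 0) + (if S ⊆ B ∧ S.card ≤ k then τ else 0) := by
      intro S
      have n1 : 0 ≤ (∑ u ∈ Bᶜ, if u ∈ S ∧ S.card ≤ k then hc φ S ^ 2 else 0) :=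
        Finset.sum_nonneg fun u _ => by split_ifs <;> positivity
      have n2 : 0 ≤ (if S ⊆ B ∧ S.card ≤ k then τ else 0) := by split_ifs <;> simp [hτ]
      by_cases hS : S.card ≤ k ∧ hc φ S ^ 2 < τ
      · rw [if_pos hS]
        by_cases hSB : S ⊆ B
        · rw [if_pos ⟨hSB, hS.1⟩]; linarith [hS.2]
        · obtain ⟨u, hu, huB⟩ := Finset.not_subset.1 hSB
          have := Finset.single_le_sum (f := fun u => if u ∈ S ∧ S.card ≤ k then hc φ S ^ 2 else 0)
            (fun u _ => by split_ifs <;> positivity) (Finset.mem_compl.2 huB)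
          simp only [hu, hS.1, true_and, if_true] at this
          simp only [hS.1] at n1 n2 ⊢
          linarith
      · rw [if_neg hS]; linarith
    refine (Finset.sum_le_sum fun S _ => m1 S).trans ?_
    rw [Finset.sum_add_distrib, Finset.sum_comm]
    have t1 : ∑ u ∈ Bᶜ, ∑ S : Finset V, (if u ∈ S ∧ S.card ≤ k then hc φ S ^ 2 else 0) ≤ 3 ^ k * s * I / 4 := by
      have : ∑ u ∈ Bᶜ, ∑ S : Finset V, (if u ∈ S ∧ S.card ≤ k then hc φ S ^ 2 else 0) ≤
          ∑ u ∈ Bᶜ, 3 ^ k * s * Iu φ u / 4 := Finset.sum_le_sum fun u hu =>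
        kkl_coord h u k hs.le (by simp [hB] at hu; exact hu.le)
      refine this.trans ?_
      refine (Finset.sum_le_sum_of_subset_of_nonneg (Finset.subset_univ _) fun u _ _ => ?_).trans_eq ?_
      · have := Iu_nonneg φ u; positivity
      · rw [hI, Finset.mul_sum, Finset.sum_div]
    have t2 : ∑ S : Finset V, (if S ⊆ B ∧ S.card ≤ k then τ else 0) ≤ τ * (A + 1) ^ k := by
      rw [← Finset.sum_filter, Finset.sum_const, nsmul_eq_mul, mul_comm]
      refine mul_le_mul_of_nonneg_left ?_ hτ
      have := card_small B k
      calc _ ≤ (((B.card + 1) ^ k : ℕ) : ℝ) := by exact_mod_cast this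
        _ ≤ _ := by push_cast; gcongr
    have : 0 ≤ I / (s ^ 2 * A) := by positivity
    linarith
  · have u1 : ∑ S : Finset V, (if S.card ≤ k ∧ hc φ S ^ 2 < τ then hc φ S ^ 2 else 0) ≤ 1 :=
      (Finset.sum_le_sum fun S _ => by split_ifs; exacts [le_rfl, by positivity]).trans (hc_sum_le h)
    have u2 : 1 ≤ I / (s ^ 2 * A) := by
      rw [le_div_iff₀ (by positivity)]
      nlinarith [mul_pos hs hs]
    have : 0 ≤ 3 ^ k * s * I / 4 := by positivity
    have : 0 ≤ τ * (A + 1) ^ k := by positivity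
    linarith

end Csec

/-! ### Tail bound and small coefficients -/

section Dsec
variable {V : Type*} [Fintype V] [DecidableEq V]

lemma PE_push' {α β : Type*} [Fintype α] [Fintype β] [DecidableEq β] {μ : V → α → ℝ} {ν : V → β → ℝ}
    (π : V → α → β) (F : (V → β) → ℝ)
    (h : ∀ x b, ∑ v, (if π x v = b then μ x v else 0) = ν x b) :
    PE μ (fun a => F (fun x => π x (a x))) = PE ν F := by
  rw [PE_push]
  congr 1
  funext x b
  rw [← h x b, Finset.sum_filter]
  refine Finset.sum_congr rfl fun v _ => ?_
  split_ifs <;> rfl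

lemma BE_single (p : ℝ) (u : V) (G : Bool → ℝ) :
    BE p (fun r : V → Bool => G (r u)) = ∑ b, bw p b * G b := by
  unfold BE
  rw [PE_coord u (bw_sum p)]
  simp only [Function.update_self]
  rw [PE_const (fun _ => bw_sum p)]

lemma Infl_nonneg {p : ℝ} (h0 : 0 ≤ p) (h1 : p ≤ 1) (f : (V → Bool) → ℝ) : 0 ≤ Infl p f :=
  Finset.sum_nonneg fun x _ => PE_nonneg (fun _ b => bw_nonneg h0 h1 b) fun ω =>
    Finset.sum_nonneg fun b _ => mul_nonneg (bw_nonneg h0 h1 b) (sq_nonneg _)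

lemma level_sum {p : ℝ} (h0 : 0 < p) (h1 : p < 1) (F : (V → Bool) → ℝ) :
    ∑ S : Finset V, (S.card : ℝ) * (FC p F S ^ 2 / (p * (1 - p)) ^ S.card) = Infl p F / 2 := by
  have e1 : ∀ S : Finset V, (S.card : ℝ) * (FC p F S ^ 2 / (p * (1 - p)) ^ S.card) =
      ∑ x, if x ∈ S then FC p F S ^ 2 / (p * (1 - p)) ^ S.card else 0 := by
    intro S
    rw [← Finset.sum_filter]
    simp
  simp only [e1]
  rw [Finset.sum_comm, Infl, Finset.sum_div]
  refine Finset.sum_congr rfl fun x _ => ?_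
  have e2 : ∑ S : Finset V, (if x ∈ S then FC p F S ^ 2 / (p * (1 - p)) ^ S.card else 0) =
      ∑ S : Finset V, FC p F S ^ 2 / (p * (1 - p)) ^ S.card -
      ∑ S ∈ (Finset.univ.erase x).powerset, FC p F S ^ 2 / (p * (1 - p)) ^ S.card := by
    have : (Finset.univ.erase x).powerset = Finset.univ.filter fun S : Finset V => x ∉ S := by
      ext S; simp [Finset.subset_erase]
    rw [this, Finset.sum_filter, ← Finset.sum_sub_distrib]
    refine Finset.sum_congr rfl fun S _ => ?_
    by_cases h : x ∈ S <;> simp [h]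
  rw [e2, parseval h0 h1, kernel h0 h1]
  have e3 : ∀ r r' : V → Bool, (Finset.univ.erase x).piecewise r r' = Function.update r x (r' x) := by
    intro r r'
    funext y
    by_cases h : y = x
    · subst h; simp [Finset.piecewise]
    · simp [Finset.piecewise, h]
  simp only [e3]
  have e4 : ∀ r : V → Bool, BE p (fun r' => F r * F (Function.update r x (r' x))) =
      ∑ b, bw p b * (F r * F (Function.update r x b)) := fun r =>
    BE_single p x (fun b => F r * F (Function.update r x b))
  simp only [e4]
  have e5 : ∀ r, ∑ b, bw p b * (F r - F (Function.update r x b)) ^ 2 =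
      F r ^ 2 - 2 * ∑ b, bw p b * (F r * F (Function.update r x b)) +
        ∑ b, bw p b * (F (Function.update r x b)) ^ 2 := by
    intro r
    simp [bw]; ring
  simp only [e5]
  unfold BE
  rw [PE_add, PE_sub, PE_mul_left, ← PE_coord x (bw_sum p) (fun r => F r ^ 2)]
  ring

lemma tail_bound {p : ℝ} (h0 : 0 < p) (h1 : p < 1) (F : (V → Bool) → ℝ) {k : ℕ} (hk : 0 < k) :
    ∑ S : Finset V, (if k < S.card then FC p F S ^ 2 / (p * (1 - p)) ^ S.card else 0) ≤
      Infl p F / (2 * k) := by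
  have hw : 0 < p * (1 - p) := mul_pos h0 (by linarith)
  have hk' : (0:ℝ) < k := by exact_mod_cast hk
  rw [← div_div, ← level_sum h0 h1 F, le_div_iff₀ hk', Finset.sum_mul]
  refine Finset.sum_le_sum fun S _ => ?_
  split_ifs with h
  · rw [mul_comm]
    refine mul_le_mul_of_nonneg_right ?_ (by positivity)
    exact_mod_cast h.le
  · simp only [zero_mul]; positivity

/-- pairs -/
def pw (p : ℝ) (q : Bool × Bool) : ℝ := bw p q.1 * bw p q.2

def mix (a : V → Bool × Bool) (r : V → Bool) : V → Bool := fun x => if r x then (a x).1 else (a x).2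

def num (b : Bool) : ℝ := if b then 1 else 0

def eS (S : Finset V) (a : V → Bool × Bool) : ℝ := ∏ x ∈ S, (num (a x).1 - num (a x).2)

lemma pw_nonneg {p : ℝ} (h0 : 0 ≤ p) (h1 : p ≤ 1) (q : Bool × Bool) : 0 ≤ pw p q :=
  mul_nonneg (bw_nonneg h0 h1 _) (bw_nonneg h0 h1 _)

lemma pw_sum (p : ℝ) : ∑ q, pw p q = 1 := by
  rw [Fintype.sum_prod_type]; simp [pw, bw]; ring

lemma F1 (p : ℝ) (f : (V → Bool) → ℝ) (S : Finset V) :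
    PE (fun _ => pw p) (fun a => hc (fun r => f (mix a r)) S * eS S a) = FC p f S := by
  unfold hc BE
  simp only [← PE_mul_right]
  rw [← PE_prod_type (fun _ => pw p) (fun _ => bw (1/2))
    (fun a r => f (mix a r) * chi S r * eS S a)]
  have e1 : ∀ c : V → (Bool × Bool) × Bool,
      f (mix (fun x => (c x).1) (fun x => (c x).2)) * chi S (fun x => (c x).2) * eS S (fun x => (c x).1) =
      f (fun x => if (c x).2 then (c x).1.1 else (c x).1.2) *
        ∏ x ∈ S, (sg (c x).2 * (num (c x).1.1 - num (c x).1.2)) := by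
    intro c
    rw [Finset.prod_mul_distrib, mul_assoc]; rfl
  simp only [e1]
  rw [PE_absorb (fun (_ : V) (q : (Bool × Bool) × Bool) => pw p q.1 * bw (1/2) q.2) S
    (fun _ c => sg c.2 * (num c.1.1 - num c.1.2))
    (fun c => f (fun x => if (c x).2 then (c x).1.1 else (c x).1.2))]
  rw [PE_push _ (fun _ (c : (Bool × Bool) × Bool) => if c.2 then c.1.1 else c.1.2) f]
  unfold FC BE
  rw [PE_absorb (fun (_ : V) => bw p) S (fun _ b => xi p b) f]
  congr 1
  funext x b
  rw [Finset.sum_filter]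
  simp only [Fintype.sum_prod_type]
  by_cases hx : x ∈ S <;> cases b <;> simp [hx, bw, pw, sg, num, xi] <;> ring

lemma F2 (p : ℝ) (f : (V → Bool) → ℝ) :
    PE (fun _ => pw p) (fun a => ∑ u, Iu (fun r => f (mix a r)) u) = Infl p f := by
  rw [PE_sum, Infl]
  refine Finset.sum_congr rfl fun u _ => ?_
  unfold Iu BE
  rw [← PE_prod_type (fun _ => pw p) (fun _ => bw (1/2))
    (fun a r => (f (mix a r) - f (mix a (flipAt u r))) ^ 2)]
  have e1 : ∀ c : V → (Bool × Bool) × Bool,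
      mix (fun x => (c x).1) (flipAt u (fun x => (c x).2)) =
      Function.update (fun x => (if (c x).2 then (c x).1 else ((c x).1.2, (c x).1.1)).1) u
        (if (c u).2 then (c u).1 else ((c u).1.2, (c u).1.1)).2 := by
    intro c; funext y
    by_cases h : y = u
    · subst h; simp [mix, flipAt]; cases (c y).2 <;> simp
    · simp [mix, flipAt, h]; cases (c y).2 <;> simp
  have e2 : ∀ c : V → (Bool × Bool) × Bool,
      mix (fun x => (c x).1) (fun x => (c x).2) =
      (fun x => (if (c x).2 then (c x).1 else ((c x).1.2, (c x).1.1)).1) := by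
    intro c; funext y
    simp [mix]; cases (c y).2 <;> simp
  simp only [e1, e2]
  rw [PE_push' (μ := fun (_ : V) (q : (Bool × Bool) × Bool) => pw p q.1 * bw (1/2) q.2)
    (ν := fun (_ : V) (q : Bool × Bool) => bw p q.1 * bw p q.2)
    (fun _ c => if c.2 then c.1 else (c.1.2, c.1.1))
    (fun d => (f (fun x => (d x).1) - f (Function.update (fun x => (d x).1) u (d u).2)) ^ 2)]
  swap
  · rintro x ⟨b1, b2⟩
    simp only [Fintype.sum_prod_type]
    cases b1 <;> cases b2 <;> simp [bw, pw] <;> ring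
  rw [PE_prod_type (fun _ => bw p) (fun _ => bw p)
    (fun Y Y' => (f Y - f (Function.update Y u (Y' u))) ^ 2)]
  congr 1; funext Y
  exact BE_single p u (fun b => (f Y - f (Function.update Y u b)) ^ 2)

lemma eS_sq (p : ℝ) (S : Finset V) :
    PE (fun _ => pw p) (fun a => eS S a ^ 2) = 2 ^ S.card * (p * (1 - p)) ^ S.card := by
  have e : ∀ a : V → Bool × Bool, eS S a ^ 2 = 1 * ∏ x ∈ S, (num (a x).1 - num (a x).2) ^ 2 := by
    intro a; rw [one_mul, Finset.prod_pow]; rfl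
  simp only [e]
  rw [PE_absorb (fun (_ : V) => pw p) S (fun _ q => (num q.1 - num q.2) ^ 2) (fun _ => 1)]
  have := PE_prod (fun (x : V) q => pw p q * if x ∈ S then (num q.1 - num q.2) ^ 2 else 1) (fun _ _ => 1)
  simp only [Finset.prod_const_one] at this
  rw [this]
  have e2 : ∀ x, ∑ v, (pw p v * if x ∈ S then (num v.1 - num v.2) ^ 2 else 1) * 1 =
      if x ∈ S then 2 * (p * (1 - p)) else 1 := by
    intro x
    rw [Fintype.sum_prod_type]
    by_cases hx : x ∈ S <;> simp [hx, pw, bw, num] <;> ring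
  simp only [e2]
  rw [Finset.prod_ite_mem]
  simp [mul_pow]

lemma eS_abs (S : Finset V) (a : V → Bool × Bool) : |eS S a| ≤ 1 := by
  unfold eS
  rw [Finset.abs_prod]
  refine Finset.prod_le_one (fun _ _ => abs_nonneg _) fun x _ => ?_
  rcases a x with ⟨b1, b2⟩
  cases b1 <;> cases b2 <;> simp [num]

lemma F3 {p : ℝ} (h0 : 0 < p) (h1 : p < 1) (f : (V → Bool) → ℝ) (S : Finset V) {ρ τ : ℝ} (hρ : 0 ≤ ρ)
    (hτ : 0 < τ) (hS : (FC p f S / (p * (1 - p)) ^ S.card) ^ 2 < ρ ^ 2 * τ) :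
    FC p f S ^ 2 / (p * (1 - p)) ^ S.card ≤
      2 ^ S.card * PE (fun _ => pw p) (fun a =>
        if hc (fun r => f (mix a r)) S ^ 2 < τ then hc (fun r => f (mix a r)) S ^ 2 else 0) +
      2 * ρ * PE (fun _ => pw p) (fun a => hc (fun r => f (mix a r)) S ^ 2) := by
  set W := (p * (1 - p)) ^ S.card with hW
  have hw : 0 < W := pow_pos (mul_pos h0 (by linarith)) _
  set A := FC p f S
  set al := A / W with hal
  have t : (A ^ 2 / W) = al * A := by rw [hal]; ring
  have f1 := F1 p f S
  set g : (V → Bool × Bool) → ℝ := fun a => hc (fun r => f (mix a r)) S with hg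
  have key : ∀ a, al * (g a * eS S a) ≤
      2 ^ S.card / 2 * (if g a ^ 2 < τ then g a ^ 2 else 0) + al ^ 2 / (2 * 2 ^ S.card) * (eS S a ^ 2) +
        ρ * g a ^ 2 := by
    intro a
    have hp2 : (0:ℝ) < 2 ^ S.card := by positivity
    split_ifs with h
    · have : 0 ≤ ρ * g a ^ 2 := by positivity
      have h2 : 0 ≤ (2 ^ S.card * g a - al * eS S a) ^ 2 / (2 * 2 ^ S.card) := by positivity
      have h3 : (2 ^ S.card * g a - al * eS S a) ^ 2 / (2 * 2 ^ S.card) =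
        2 ^ S.card / 2 * g a ^ 2 + al ^ 2 / (2 * 2 ^ S.card) * (eS S a ^ 2) - al * (g a * eS S a) := by
        field_simp; ring
      linarith
    · have n2 : 0 ≤ al ^ 2 / (2 * 2 ^ S.card) * (eS S a ^ 2) := by positivity
      have m1 : al * (g a * eS S a) ≤ |al| * |g a| := by
        refine (le_abs_self _).trans ?_
        rw [abs_mul, abs_mul]
        have := eS_abs S a
        have := mul_le_mul_of_nonneg_left this (mul_nonneg (abs_nonneg al) (abs_nonneg (g a)))
        linarith
      have m2 : |al| * |g a| ≤ ρ * g a ^ 2 := by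
        refine abs_le_of_sq_le_sq' ?_ (by positivity) |>.2
        rw [mul_pow, sq_abs, sq_abs]
        have : τ ≤ g a ^ 2 := not_lt.1 h
        have := mul_le_mul_of_nonneg_left this (sq_nonneg ρ)
        nlinarith [sq_nonneg (g a)]
      linarith
  have := PE_mono (μ := fun _ : V => pw p) (fun _ => pw_nonneg h0.le h1.le) key
  rw [PE_mul_left, f1, PE_add, PE_add, PE_mul_left, PE_mul_left, PE_mul_left, eS_sq, ← hW] at this
  have e : al ^ 2 / (2 * 2 ^ S.card) * (2 ^ S.card * W) = al * A / 2 := by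
    rw [hal]; field_simp
  rw [e] at this
  rw [t]
  linarith

lemma claimF {p : ℝ} (h0 : 0 < p) (h1 : p < 1) {f : (V → Bool) → ℝ} (hf : ∀ r, f r = 0 ∨ f r = 1)
    (k : ℕ) {ρ τ s A : ℝ} (hρ : 0 ≤ ρ) (hτ : 0 < τ) (hs : 0 < s) (hA : 0 < A) :
    ∑ S : Finset V, (if S.card ≤ k ∧ (FC p f S / (p * (1 - p)) ^ S.card) ^ 2 < ρ ^ 2 * τ then
      FC p f S ^ 2 / (p * (1 - p)) ^ S.card else 0) ≤
    2 ^ k * (3 ^ k * s * Infl p f / 4 + τ * (A + 1) ^ k + Infl p f / (s ^ 2 * A)) + 2 * ρ := by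
  set g : Finset V → (V → Bool × Bool) → ℝ := fun S a => hc (fun r => f (mix a r)) S with hg
  have hμ : ∀ (x : V) v, 0 ≤ (fun _ : V => pw p) x v := fun _ => pw_nonneg h0.le h1.le
  have m1 : ∀ S : Finset V, (if S.card ≤ k ∧ (FC p f S / (p * (1 - p)) ^ S.card) ^ 2 < ρ ^ 2 * τ then
      FC p f S ^ 2 / (p * (1 - p)) ^ S.card else 0) ≤
      2 ^ k * PE (fun _ => pw p) (fun a => if S.card ≤ k ∧ g S a ^ 2 < τ then g S a ^ 2 else 0) +
        2 * ρ * PE (fun _ => pw p) (fun a => g S a ^ 2) := by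
    intro S
    have n1 : 0 ≤ PE (fun _ => pw p) (fun a => if S.card ≤ k ∧ g S a ^ 2 < τ then g S a ^ 2 else 0) :=
      PE_nonneg hμ fun a => by split_ifs <;> positivity
    have n2 : 0 ≤ PE (fun _ => pw p) (fun a => g S a ^ 2) := PE_nonneg hμ fun a => by positivity
    split_ifs with h
    · have := F3 h0 h1 f S hρ hτ h.2
      refine this.trans ?_
      simp only [h.1, true_and]
      simp only [h.1, true_and] at n1
      have : (2:ℝ) ^ S.card ≤ 2 ^ k := pow_le_pow_right₀ (by norm_num) h.1
      have := mul_le_mul_of_nonneg_right this n1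
      linarith
    · positivity
  refine (Finset.sum_le_sum fun S _ => m1 S).trans ?_
  rw [Finset.sum_add_distrib, ← Finset.mul_sum, ← Finset.mul_sum, ← PE_sum, ← PE_sum]
  have m2 : PE (fun _ => pw p) (fun a => ∑ S : Finset V, g S a ^ 2) ≤ 1 := by
    have := PE_mono hμ (F := fun a => ∑ S : Finset V, g S a ^ 2) (G := fun _ => 1)
      (fun a => hc_sum_le (fun r => hf _))
    rwa [PE_one (fun _ => pw_sum p)] at this
  have m3 := PE_mono hμ (fun a => kkl_cube (φ := fun r => f (mix a r)) (fun r => hf _) k hs hτ.le hA)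
  have e : PE (fun _ => pw p) (fun a => 3 ^ k * s * (∑ u, Iu (fun r => f (mix a r)) u) / 4 + τ * (A + 1) ^ k +
      (∑ u, Iu (fun r => f (mix a r)) u) / (s ^ 2 * A)) =
      3 ^ k * s * Infl p f / 4 + τ * (A + 1) ^ k + Infl p f / (s ^ 2 * A) := by
    have : ∀ z : ℝ, 3 ^ k * s * z / 4 + τ * (A + 1) ^ k + z / (s ^ 2 * A) =
      (3 ^ k * s / 4 + 1 / (s ^ 2 * A)) * z + τ * (A + 1) ^ k := fun z => by ring
    simp only [this]
    rw [PE_add, PE_mul_left, F2, PE_const (fun _ => pw_sum p)]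
  rw [e] at m3
  have := mul_le_mul_of_nonneg_left m3 (by positivity : (0:ℝ) ≤ 2 ^ k)
  have := mul_le_mul_of_nonneg_left m2 (by positivity : (0:ℝ) ≤ 2 * ρ)
  simp only [hg] at *
  linarith

lemma claimF' {p : ℝ} (h0 : 0 < p) (h1 : p < 1) {f : (V → Bool) → ℝ} (hf : ∀ r, f r = 0 ∨ f r = 1)
    {k : ℕ} (hk : 4 ≤ k) (hI : Infl p f ≤ k) :
    ∑ S : Finset V, (if S.card ≤ k ∧ (FC p f S / (p * (1 - p)) ^ S.card) ^ 2 < (1/2 : ℝ) ^ (18 * k ^ 2) then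
      FC p f S ^ 2 / (p * (1 - p)) ^ S.card else (0:ℝ)) ≤ 1 / (k : ℝ) := by
  have h := claimF h0 h1 hf k (ρ := (1/2) ^ (k ^ 2)) (τ := (1/2) ^ (16 * k ^ 2)) (s := (1/2) ^ (5 * k))
    (A := 2 ^ (13 * k)) (by positivity) (by positivity) (by positivity) (by positivity)
  have e : (((1:ℝ)/2) ^ (k ^ 2)) ^ 2 * (1/2) ^ (16 * k ^ 2) = (1/2) ^ (18 * k ^ 2) := by
    rw [← pow_mul, ← pow_add]; congr 1; ring
  rw [e] at h
  refine h.trans ?_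
  have hI0 := Infl_nonneg h0.le h1.le f
  set I := Infl p f
  have hk0 : (0:ℝ) < k := by exact_mod_cast (by omega : 0 < k)
  -- k ≤ 2^(k-2)
  have kk : ∀ n : ℕ, 4 ≤ n → 4 * n ≤ 2 ^ n := by
    intro n hn
    induction n, hn using Nat.le_induction with
    | base => norm_num
    | succ n hn ih => rw [pow_succ]; omega
  have k1 : (4 * k : ℝ) ≤ 2 ^ k := by exact_mod_cast kk k hk
  have k2 : (1/2 : ℝ) ^ k ≤ 1 / (4 * k) := by
    rw [one_div_pow]; exact one_div_le_one_div_of_le (by positivity) k1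
  have half_le : ∀ {m n : ℕ}, m ≤ n → (1/2:ℝ) ^ n ≤ (1/2) ^ m := fun h =>
    pow_le_pow_of_le_one (by norm_num) (by norm_num) h
  have two_half : ∀ n : ℕ, (2:ℝ) ^ n * (1/2) ^ n = 1 := fun n => by rw [← mul_pow]; norm_num
  have hIk : I ≤ 2 ^ k / 4 := by linarith
  have a1 : (2:ℝ) ^ k * (3 ^ k * (1/2) ^ (5 * k) * I / 4) ≤ (1/2) ^ k := by
    have e3 : (3:ℝ) ^ k ≤ 4 ^ k := pow_le_pow_left₀ (by norm_num) (by norm_num) k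
    calc (2:ℝ) ^ k * (3 ^ k * (1/2) ^ (5 * k) * I / 4)
        ≤ (2:ℝ) ^ k * (4 ^ k * (1/2) ^ (5 * k) * (2 ^ k * 4) / 4) := by
          gcongr
          have : (0:ℝ) < 2 ^ k := by positivity
          linarith
      _ = (2 * 4 * 2 * (1/2)^5) ^ k := by rw [mul_pow, mul_pow, mul_pow, ← pow_mul]; ring
      _ ≤ (1/2) ^ k := by norm_num
  have a2 : (2:ℝ) ^ k * ((1/2) ^ (16 * k ^ 2) * (2 ^ (13 * k) + 1) ^ k) ≤ (1/2) ^ k := by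
    have e1 : ((2:ℝ) ^ (13 * k) + 1) ≤ 2 ^ (14 * k) := by
      have : (1:ℝ) ≤ 2 ^ (13 * k) := one_le_pow₀ (by norm_num)
      have h2 : (2:ℝ) ≤ 2 ^ k := by
        calc (2:ℝ) = 2 ^ 1 := by norm_num
          _ ≤ 2 ^ k := pow_le_pow_right₀ (by norm_num) (by omega)
      rw [show 14 * k = 13 * k + k by ring, pow_add]
      nlinarith
    calc (2:ℝ) ^ k * ((1/2) ^ (16 * k ^ 2) * (2 ^ (13 * k) + 1) ^ k)
        ≤ 2 ^ k * ((1/2) ^ (16 * k ^ 2) * (2 ^ (14 * k)) ^ k) := by gcongr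
      _ = (2 ^ k * 2 ^ (14 * k ^ 2)) * ((1/2) ^ (16 * k ^ 2)) := by rw [← pow_mul]; ring_nf
      _ = 2 ^ (k + 14 * k ^ 2) * ((1/2) ^ (16 * k ^ 2)) := by rw [pow_add]
      _ ≤ 2 ^ (k + 14 * k ^ 2) * ((1/2) ^ ((k + 14 * k^2) + k)) := by
          gcongr ?_ * ?_
          exact half_le (by nlinarith)
      _ = (1/2) ^ k := by rw [pow_add (1/2 : ℝ), ← mul_assoc, two_half, one_mul]
  have a3 : (2:ℝ) ^ k * (I / (((1/2) ^ (5 * k)) ^ 2 * 2 ^ (13 * k))) ≤ (1/2) ^ k := by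
    have e1 : (((1/2:ℝ) ^ (5 * k)) ^ 2 * 2 ^ (13 * k)) = 2 ^ (3 * k) := by
      rw [← pow_mul, show 13 * k = 5 * k * 2 + 3 * k by ring, pow_add (2:ℝ), ← mul_assoc,
        mul_comm ((1/2:ℝ)^_), two_half, one_mul]
    rw [e1]
    calc (2:ℝ) ^ k * (I / 2 ^ (3 * k)) ≤ 2 ^ k * (2 ^ k / 2 ^ (3 * k)) := by
          gcongr
          have : (0:ℝ) < 2 ^ k := by positivity
          linarith
      _ = (1/2) ^ k := by
          rw [show 3 * k = k + k + k by ring, pow_add, pow_add, one_div_pow]; field_simp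
  have a4 : 2 * (1/2:ℝ) ^ (k ^ 2) ≤ (1/2) ^ k := by
    calc 2 * (1/2:ℝ) ^ (k ^ 2) ≤ 2 * (1/2) ^ (k + 1) := by
          gcongr ?_ * ?_
          exact half_le (by nlinarith)
      _ = (1/2) ^ k := by rw [pow_succ]; ring
  have : (2:ℝ) ^ k * (3 ^ k * (1/2) ^ (5 * k) * I / 4 + (1/2) ^ (16 * k ^ 2) * (2 ^ (13 * k) + 1) ^ k +
      I / (((1/2) ^ (5 * k)) ^ 2 * 2 ^ (13 * k))) + 2 * (1/2) ^ (k ^ 2) ≤ 4 * (1/2) ^ k := by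
    rw [mul_add, mul_add]; linarith
  refine this.trans ?_
  calc 4 * (1/2:ℝ) ^ k ≤ 4 * (1 / (4 * k)) := by gcongr
    _ = 1 / k := by field_simp

end Dsec

/-! ### The pool argument -/

def Jset {V : Type*} (F : Finset (Finset V)) (Om : V → Bool) : Finset V :=
  (F.filter fun S => ∀ y ∈ S, Om y = true).biUnion id

section Esec
variable {V : Type*} [Fintype V] [DecidableEq V]

lemma mem_Jset {F : Finset (Finset V)} {Om : V → Bool} {x : V} :
    x ∈ Jset F Om ↔ ∃ S ∈ F, (∀ y ∈ S, Om y = true) ∧ x ∈ S := by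
  simp only [Jset, Finset.mem_biUnion, Finset.mem_filter, id]
  constructor
  · rintro ⟨S, ⟨h1, h2⟩, h3⟩; exact ⟨S, h1, h2, h3⟩
  · rintro ⟨S, h1, h2, h3⟩; exact ⟨S, ⟨h1, h2⟩, h3⟩

lemma Jset_sub {F : Finset (Finset V)} {Om : V → Bool} {x : V} (h : x ∈ Jset F Om) : Om x = true := by
  obtain ⟨S, _, h2, h3⟩ := mem_Jset.1 h
  exact h2 x h3

lemma Jset_update {F : Finset (Finset V)} {Om : V → Bool} {x : V}
    (h : x ∉ Jset F (Function.update Om x true)) (b : Bool) :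
    Jset F (Function.update Om x b) = Jset F (Function.update Om x true) := by
  cases b
  swap
  · rfl
  ext z
  rw [mem_Jset, mem_Jset]
  constructor
  · rintro ⟨S, h1, h2, h3⟩
    refine ⟨S, h1, fun y hy => ?_, h3⟩
    have := h2 y hy
    by_cases e : y = x
    · subst e; simp
    · rw [Function.update_of_ne e] at this ⊢; exact this
  · rintro ⟨S, h1, h2, h3⟩
    have hx : x ∉ S := fun hx => h (mem_Jset.2 ⟨S, h1, h2, hx⟩)
    refine ⟨S, h1, fun y hy => ?_, h3⟩
    have := h2 y hy
    have e : y ≠ x := ne_of_mem_of_not_mem hy hx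
    rw [Function.update_of_ne e] at this ⊢; exact this

def band (Om r : V → Bool) : V → Bool := fun x => Om x && r x

lemma num_prod (S : Finset V) (Om : V → Bool) :
    ∏ x ∈ S, num (Om x) = if ∀ y ∈ S, Om y = true then 1 else 0 := by
  split_ifs with h
  · exact Finset.prod_eq_one fun x hx => by simp [num, h x hx]
  · push Not at h
    obtain ⟨y, hy, h⟩ := h
    exact Finset.prod_eq_zero hy (by simp [num, h])

lemma prob_sub (q : ℝ) (S : Finset V) :
    BE q (fun Om => ∏ x ∈ S, num (Om x)) = q ^ S.card := by
  have := PE_absorb (fun _ : V => bw q) S (fun _ => num) (fun _ => 1)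
  simp only [one_mul] at this
  unfold BE
  rw [this]
  have h2 := PE_prod (fun (x : V) v => bw q v * if x ∈ S then num v else 1) (fun _ _ => 1)
  simp only [Finset.prod_const_one] at h2
  rw [h2]
  have : ∀ x : V, ∑ v, (bw q v * if x ∈ S then num v else 1) * 1 = if x ∈ S then q else 1 := by
    intro x; by_cases hx : x ∈ S <;> simp [hx, bw, num]
  simp only [this]
  rw [Finset.prod_ite_mem]; simp

lemma pool_coef {p m : ℝ} (hm : 1 < m) (h1 : p < 1) (f : (V → Bool) → ℝ) (S : Finset V) :
    BE (m * p) (fun Om => (∏ x ∈ S, num (Om x)) * FC (1 / m) (fun r => f (band Om r)) S) =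
      ((1 - 1 / m) / (1 - p)) ^ S.card * FC p f S := by
  have hq : 1 - p ≠ 0 := by linarith
  have hm0 : m ≠ 0 := by linarith
  unfold FC BE
  simp only [← PE_mul_left]
  rw [← PE_prod_type (fun _ => bw (m * p)) (fun _ => bw (1 / m))
    (fun Om r => (∏ x ∈ S, num (Om x)) * (f (band Om r) * ∏ x ∈ S, xi (1 / m) (r x)))]
  have e1 : ∀ c : V → Bool × Bool, (∏ x ∈ S, num (c x).1) *
      (f (band (fun x => (c x).1) (fun x => (c x).2)) * ∏ x ∈ S, xi (1 / m) (c x).2) =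
      f (fun x => (c x).1 && (c x).2) * ∏ x ∈ S, (num (c x).1 * xi (1 / m) (c x).2) := by
    intro c
    rw [Finset.prod_mul_distrib, mul_left_comm]; rfl
  have e2 : ∀ c : V → Bool, ((1 - 1 / m) / (1 - p)) ^ S.card * (f c * ∏ x ∈ S, xi p (c x)) =
      f c * ∏ x ∈ S, ((1 - 1 / m) / (1 - p) * xi p (c x)) := by
    intro c
    rw [Finset.prod_mul_distrib, Finset.prod_const]; ring
  simp only [e1, e2]
  rw [PE_absorb (fun (_ : V) (q : Bool × Bool) => bw (m * p) q.1 * bw (1 / m) q.2) S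
    (fun _ c => num c.1 * xi (1 / m) c.2) (fun c => f (fun x => (c x).1 && (c x).2)),
    PE_absorb (fun (_ : V) => bw p) S (fun _ b => (1 - 1 / m) / (1 - p) * xi p b) f]
  rw [PE_push' (μ := fun (x : V) (v : Bool × Bool) => bw (m * p) v.1 * bw (1 / m) v.2 *
    if x ∈ S then num v.1 * xi (1 / m) v.2 else 1)
    (ν := fun x v => bw p v * if x ∈ S then (1 - 1 / m) / (1 - p) * xi p v else 1)
    (fun _ v => v.1 && v.2) f]
  intro x b
  rw [Fintype.sum_prod_type]
  by_cases hx : x ∈ S <;> cases b <;> simp [hx, bw, num, xi] <;> field_simp <;> ring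

lemma low {p m : ℝ} (h0 : 0 < p) (h1 : p < 1) (hm : 1 < m) (hmp : m * p ≤ 1) (f : (V → Bool) → ℝ)
    (F : Finset (Finset V)) :
    ∑ S ∈ F, (1 - 1 / m) ^ S.card * (FC p f S ^ 2 / (p * (1 - p)) ^ S.card) ≤
      BE (m * p) (fun Om => BE (1 / m) (fun r => BE (1 / m) (fun r' =>
        f (band Om r) * f (band Om ((Jset F Om).piecewise r r'))))) := by
  have hm0 : 0 < m := by linarith
  have hm1 : 1 / m < 1 := by rw [div_lt_one hm0]; exact hm
  have hm2 : 0 < 1 / m := by positivity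
  have hq : 0 < m * p := by positivity
  set G : (V → Bool) → Finset V → ℝ := fun Om S => FC (1 / m) (fun r => f (band Om r)) S with hG
  set v := (1 / m) * (1 - 1 / m) with hv
  have hv0 : 0 < v := mul_pos hm2 (by linarith)
  have e1 : ∀ Om, BE (1 / m) (fun r => BE (1 / m) (fun r' =>
        f (band Om r) * f (band Om ((Jset F Om).piecewise r r')))) =
        ∑ S ∈ (Jset F Om).powerset, G Om S ^ 2 / v ^ S.card := fun Om =>
    (kernel hm2 hm1 (fun r => f (band Om r)) (Jset F Om)).symm
  have e2 : ∀ Om, ∑ S ∈ F, (∏ x ∈ S, num (Om x)) * (G Om S ^ 2 / v ^ S.card) ≤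
      ∑ S ∈ (Jset F Om).powerset, G Om S ^ 2 / v ^ S.card := by
    intro Om
    simp only [num_prod, ite_mul, one_mul, zero_mul]
    rw [← Finset.sum_filter]
    refine Finset.sum_le_sum_of_subset_of_nonneg ?_ fun S _ _ => by positivity
    intro S hS
    rw [Finset.mem_filter] at hS
    rw [Finset.mem_powerset]
    intro x hx
    exact mem_Jset.2 ⟨S, hS.1, hS.2, hx⟩
  simp only [e1]
  have hμ : ∀ (x : V) b, 0 ≤ (fun _ : V => bw (m * p)) x b := fun _ b => bw_nonneg hq.le hmp b
  refine le_trans ?_ (PE_mono hμ e2)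
  rw [PE_sum]
  refine Finset.sum_le_sum fun S _ => ?_
  have idem : ∀ Om : V → Bool, (∏ x ∈ S, num (Om x)) ^ 2 = ∏ x ∈ S, num (Om x) := by
    intro Om; rw [num_prod]; split_ifs <;> norm_num
  have cs := PE_cauchy hμ (fun Om => ∏ x ∈ S, num (Om x)) (fun Om => (∏ x ∈ S, num (Om x)) * G Om S)
  simp only [← mul_assoc, ← sq, mul_pow, idem] at cs
  have c1 := pool_coef (p := p) hm h1 f S
  have c2 := prob_sub (m * p) S
  unfold BE at c1 c2
  rw [c1, c2] at cs
  have e3 : PE (fun _ => bw (m * p)) (fun Om => (∏ x ∈ S, num (Om x)) * (G Om S ^ 2 / v ^ S.card)) =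
      PE (fun _ => bw (m * p)) (fun Om => (∏ x ∈ S, num (Om x)) * G Om S ^ 2) / v ^ S.card := by
    rw [div_eq_mul_inv, ← PE_mul_right]
    congr 1; funext Om; ring
  rw [e3]
  set X := PE (fun _ => bw (m * p)) (fun Om => (∏ x ∈ S, num (Om x)) * G Om S ^ 2)
  set n := S.card
  have hw : 0 < 1 - p := by linarith
  have g1 : (((1 - 1 / m) / (1 - p)) ^ n * FC p f S) ^ 2 / ((m * p) ^ n * v ^ n) ≤ X / v ^ n := by
    rw [← div_div]
    gcongr
    rw [div_le_iff₀ (by positivity)]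
    linarith
  refine le_trans ?_ g1
  have g2 : (((1 - 1 / m) / (1 - p)) ^ n * FC p f S) ^ 2 / ((m * p) ^ n * v ^ n) =
      (1 - 1 / m) ^ n * (FC p f S ^ 2 / (p * (1 - p)) ^ n) * (1 / (1 - p)) ^ n := by
    rw [mul_pow, ← pow_mul, mul_comm n 2, pow_mul, ← mul_pow]
    have : ((1 - 1 / m) / (1 - p)) ^ 2 = (1 - 1 / m) * (1 / (1 - p)) * ((m * p * v) / (p * (1 - p))) := by
      rw [hv]; field_simp
    rw [this, mul_pow, mul_pow, div_pow (m * p * v)]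
    have hU : (m * p * v) ^ n ≠ 0 := by positivity
    generalize (m * p * v) ^ n = U at hU ⊢
    generalize (1 - 1 / m) ^ n = U1
    generalize (1 / (1 - p)) ^ n = U2
    generalize (p * (1 - p)) ^ n = U3
    field_simp
  rw [g2]
  refine le_mul_of_one_le_right ?_ (one_le_pow₀ ?_)
  · have : 0 < 1 - 1 / m := by linarith
    positivity
  · rw [le_div_iff₀ hw]; linarith

end Esec

/-! ### Hybrid argument -/

abbrev B4 := Bool × Bool × Bool × Bool

def w4 (p m : ℝ) (q : B4) : ℝ :=
  bw (m * p) q.1 * (bw (1 / m) q.2.1 * (bw (1 / m) q.2.2.1 * bw p q.2.2.2))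

section Fsec
variable {V : Type*} [Fintype V] [DecidableEq V]

def Yc (a : V → B4) : V → Bool := fun x => (a x).1 && (a x).2.1

def Zc (F : Finset (Finset V)) (H : Finset V) (a : V → B4) : V → Bool := fun x =>
  if x ∈ Jset F (fun y => (a y).1) then (a x).2.1
  else if x ∈ H then (a x).2.2.2 else (a x).1 && (a x).2.2.1

def Dx (f : (V → Bool) → ℝ) (x : V) (r : V → Bool) : ℝ :=
  f (Function.update r x true) - f (Function.update r x false)

lemma w4_nonneg {p m : ℝ} (h0 : 0 < p) (h1 : p < 1) (hm : 1 < m) (hmp : m * p ≤ 1) (q : B4) : 0 ≤ w4 p m q := by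
  have hm0 : 0 < m := by linarith
  have hm1 : 1 / m ≤ 1 := by rw [div_le_one hm0]; exact hm.le
  have hm2 : 0 ≤ 1 / m := by positivity
  have hq : 0 ≤ m * p := by positivity
  exact mul_nonneg (bw_nonneg hq hmp _) (mul_nonneg (bw_nonneg hm2 hm1 _)
    (mul_nonneg (bw_nonneg hm2 hm1 _) (bw_nonneg h0.le h1.le _)))

lemma w4_sum (p m : ℝ) : ∑ q, w4 p m q = 1 := by
  simp only [Fintype.sum_prod_type]
  simp [w4, bw]; ring

lemma le_update_true (r : V → Bool) (x : V) (b : Bool) :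
    Function.update r x b ≤ Function.update r x true := by
  intro y; by_cases h : y = x
  · subst h; simp
  · simp [h]

lemma update_false_le (r : V → Bool) (x : V) (b : Bool) :
    Function.update r x false ≤ Function.update r x b := by
  intro y; by_cases h : y = x
  · subst h; simp
  · simp [h]

lemma Dx_nonneg {f : (V → Bool) → ℝ} (hmon : Monotone f) (x : V) (r : V → Bool) : 0 ≤ Dx f x r :=
  sub_nonneg.2 (hmon (le_update_true r x false))

lemma hybrid_step {p m : ℝ} (h0 : 0 < p) (h1 : p < 1) (hm : 1 < m) (hmp : m * p ≤ 1)
    {f : (V → Bool) → ℝ} (hf : ∀ r, f r = 0 ∨ f r = 1) (hmon : Monotone f)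
    (F : Finset (Finset V)) (H : Finset V) (x : V) (hx : x ∉ H) :
    PE (fun _ => w4 p m) (fun a => f (Yc a) * f (Zc F H a)) -
      PE (fun _ => w4 p m) (fun a => f (Yc a) * f (Zc F (insert x H) a)) ≤
      p / m * PE (fun _ => w4 p m) (fun a => Dx f x (Yc a)) := by
  have hm0 : 0 < m := by linarith
  rw [← PE_sub, ← PE_mul_left, PE_coord x (w4_sum p m)]
  refine PE_mono (fun _ => w4_nonneg h0 h1 hm hmp) fun a => ?_
  have f0 : ∀ r, 0 ≤ f r := fun r => by rcases hf r with h | h <;> rw [h]; norm_num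
  have f1 : ∀ r, f r ≤ 1 := fun r => by rcases hf r with h | h <;> rw [h]; norm_num
  have hD : 0 ≤ p / m * Dx f x (Yc a) := mul_nonneg (by positivity) (Dx_nonneg hmon x _)
  have om : ∀ v : B4, (fun y => (Function.update a x v y).1) = Function.update (fun y => (a y).1) x v.1 := by
    intro v; funext y; by_cases h : y = x
    · subst h; simp
    · simp [h]
  by_cases hJ : x ∈ Jset F (Function.update (fun y => (a y).1) x true)
  · refine le_trans ?_ hD
    refine Finset.sum_nonpos fun v _ => mul_nonpos_of_nonneg_of_nonpos (w4_nonneg h0 h1 hm hmp v) ?_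
    rw [← mul_sub]
    refine mul_nonpos_of_nonneg_of_nonpos (f0 _) (sub_nonpos.2 (hmon ?_))
    intro y
    unfold Zc
    rw [om v]
    by_cases h : y = x
    · subst h
      simp only [Function.update_self]
      rcases v with ⟨b, v⟩
      cases b
      · have : y ∉ Jset F (Function.update (fun y => (a y).1) y false) := fun h => by
          have := Jset_sub h; simp at this
        simp [this, hx]
      · simp [hJ]
    · simp [h]
  · have hJu : ∀ v : B4, Jset F (fun y => (Function.update a x v y).1) =
        Jset F (Function.update (fun y => (a y).1) x true) := fun v => by
      rw [om v]; exact Jset_update hJ v.1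
    set z := Zc F H (Function.update a x (true, false, false, false)) with hz
    have z1 : ∀ v : B4, Zc F H (Function.update a x v) = Function.update z x (v.1 && v.2.2.1) := by
      intro v; funext y
      by_cases h : y = x
      · subst h
        unfold Zc; rw [hJu v]
        simp [hJ, hx]
      · rw [hz]
        rw [Function.update_of_ne h]
        unfold Zc; rw [hJu v, hJu _]
        simp [h]
    have z2 : ∀ v : B4, Zc F (insert x H) (Function.update a x v) = Function.update z x v.2.2.2 := by
      intro v; funext y
      by_cases h : y = x
      · subst h
        unfold Zc; rw [hJu v]
        simp [hJ]
      · rw [hz]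
        rw [Function.update_of_ne h]
        unfold Zc; rw [hJu v, hJu _]
        simp [h]
    have y1 : ∀ v : B4, Yc (Function.update a x v) = Function.update (Yc a) x (v.1 && v.2.1) := by
      intro v; funext y
      by_cases h : y = x
      · subst h; simp [Yc]
      · simp [h, Yc]
    simp only [z1, z2, y1]
    have d1 : 0 ≤ f (Function.update z x true) - f (Function.update z x false) := Dx_nonneg hmon x z
    have d2 : f (Function.update z x true) - f (Function.update z x false) ≤ 1 := by
      linarith [f1 (Function.update z x true), f0 (Function.update z x false)]
    have d3 : 0 ≤ Dx f x (Yc a) := Dx_nonneg hmon x _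
    unfold Dx at d3 ⊢
    obtain ⟨Z1, hZ1⟩ : ∃ t, f (Function.update z x true) = t := ⟨_, rfl⟩
    obtain ⟨Z0, hZ0⟩ : ∃ t, f (Function.update z x false) = t := ⟨_, rfl⟩
    obtain ⟨Y1, hY1⟩ : ∃ t, f (Function.update (Yc a) x true) = t := ⟨_, rfl⟩
    obtain ⟨Y0, hY0⟩ : ∃ t, f (Function.update (Yc a) x false) = t := ⟨_, rfl⟩
    have gZ : ∀ b, f (Function.update z x b) = if b then Z1 else Z0 := by
      intro b; cases b <;> simp [hZ1, hZ0]
    have gY : ∀ b, f (Function.update (Yc a) x b) = if b then Y1 else Y0 := by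
      intro b; cases b <;> simp [hY1, hY0]
    rw [hZ1, hZ0] at d1 d2
    rw [hY1, hY0] at d3 ⊢
    simp only [gZ, gY, Fintype.sum_prod_type]
    have e : ∑ b1 : Bool, ∑ b2 : Bool, ∑ b3 : Bool, ∑ b4 : Bool, w4 p m (b1, b2, b3, b4) *
        ((if (b1 && b2) then Y1 else Y0) * (if (b1 && b3) then Z1 else Z0) -
          (if (b1 && b2) then Y1 else Y0) * (if b4 then Z1 else Z0)) =
        (Z1 - Z0) * (Y1 - Y0) * (p / m - p ^ 2) := by
      simp [w4, bw]
      field_simp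
      ring
    have fin : (Z1 - Z0) * (Y1 - Y0) * (p / m - p ^ 2) ≤ p / m * (Y1 - Y0) := by
      have h3 : (Z1 - Z0) * (Y1 - Y0) * (p / m - p ^ 2) ≤ (Z1 - Z0) * (Y1 - Y0) * (p / m) := by
        refine mul_le_mul_of_nonneg_left ?_ (mul_nonneg d1 d3)
        nlinarith [sq_nonneg p]
      have h4 : (Z1 - Z0) * ((Y1 - Y0) * (p / m)) ≤ 1 * ((Y1 - Y0) * (p / m)) :=
        mul_le_mul_of_nonneg_right d2 (mul_nonneg d3 (by positivity))
      linarith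
    exact e.le.trans fin

lemma hybrid {p m : ℝ} (h0 : 0 < p) (h1 : p < 1) (hm : 1 < m) (hmp : m * p ≤ 1)
    {f : (V → Bool) → ℝ} (hf : ∀ r, f r = 0 ∨ f r = 1) (hmon : Monotone f)
    (F : Finset (Finset V)) (H : Finset V) :
    PE (fun _ => w4 p m) (fun a => f (Yc a) * f (Zc F ∅ a)) -
      PE (fun _ => w4 p m) (fun a => f (Yc a) * f (Zc F H a)) ≤
      ∑ x ∈ H, p / m * PE (fun _ => w4 p m) (fun a => Dx f x (Yc a)) := by
  induction H using Finset.induction_on with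
  | empty => simp
  | insert x H hx ih =>
    have := hybrid_step h0 h1 hm hmp hf hmon F H x hx
    rw [Finset.sum_insert hx]
    linarith

lemma PE_Yc {p m : ℝ} (hm : 1 < m) (G : (V → Bool) → ℝ) :
    PE (fun _ => w4 p m) (fun a => G (Yc a)) = BE p G := by
  have hm0 : m ≠ 0 := by linarith
  refine PE_push' (fun _ (v : B4) => v.1 && v.2.1) G ?_
  intro x b
  simp only [Fintype.sum_prod_type]
  cases b <;> simp [w4, bw] <;> field_simp <;> ring

lemma Infl_eq {p : ℝ} {f : (V → Bool) → ℝ} (hf : ∀ r, f r = 0 ∨ f r = 1) (hmon : Monotone f) :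
    Infl p f = 2 * p * (1 - p) * ∑ x, BE p (Dx f x) := by
  rw [Infl, Finset.mul_sum]
  refine Finset.sum_congr rfl fun x _ => ?_
  rw [BE_coord p x]
  unfold BE
  rw [← PE_mul_left]
  congr 1
  funext r
  have hD : (Dx f x r) ^ 2 = Dx f x r := by
    have := Dx_nonneg hmon x r
    unfold Dx at this ⊢
    rcases hf (Function.update r x true) with a | a <;> rcases hf (Function.update r x false) with b | b <;>
      rw [a, b] at this ⊢ <;> first | (exfalso; linarith) | norm_num
  rw [← hD]
  simp [Dx, bw]
  ring

def gT (p : ℝ) (f : (V → Bool) → ℝ) (T : Finset V) : ℝ := BE p (fun w => f (fun x => decide (x ∈ T) || w x))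

def Tc (F : Finset (Finset V)) (a : V → B4) : Finset V :=
  (Jset F (fun y => (a y).1)).filter fun x => (a x).2.1 = true

lemma w4_E (p m : ℝ) (G : (V → Bool) → (V → Bool) → (V → Bool) → (V → Bool) → ℝ) :
    PE (fun _ => w4 p m) (fun a : V → B4 => G (fun x => (a x).1) (fun x => (a x).2.1) (fun x => (a x).2.2.1)
      (fun x => (a x).2.2.2)) =
    BE (m * p) (fun Om => BE (1 / m) (fun r => BE (1 / m) (fun r' => BE p (fun w => G Om r r' w)))) := by
  have e1 := PE_prod_type (V := V) (fun _ => bw (m * p)) (fun _ (q : Bool × Bool × Bool) => bw (1 / m) q.1 * (bw (1 / m) q.2.1 * bw p q.2.2))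
    (fun Om c => G Om (fun x => (c x).1) (fun x => (c x).2.1) (fun x => (c x).2.2))
  refine e1.trans ?_
  unfold BE
  congr 1; funext Om
  have e2 := PE_prod_type (V := V) (fun _ => bw (1 / m)) (fun _ (q : Bool × Bool) => bw (1 / m) q.1 * bw p q.2)
    (fun r c => G Om r (fun x => (c x).1) (fun x => (c x).2))
  refine e2.trans ?_
  congr 1; funext r
  exact PE_prod_type (V := V) (fun _ => bw (1 / m)) (fun _ => bw p) (fun r' w => G Om r r' w)

lemma BE_mono {p : ℝ} (h0 : 0 ≤ p) (h1 : p ≤ 1) {F G : (V → Bool) → ℝ} (h : ∀ a, F a ≤ G a) :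
    BE p F ≤ BE p G := PE_mono (fun _ => bw_nonneg h0 h1) h

lemma pool_main {p m : ℝ} (h0 : 0 < p) (h1 : p ≤ 1 / 2) (hm : 1 < m) (hmp : m * p ≤ 1)
    {f : (V → Bool) → ℝ} (hf : ∀ r, f r = 0 ∨ f r = 1) (hmon : Monotone f) (F : Finset (Finset V)) :
    ∑ S ∈ F, (1 - 1 / m) ^ S.card * (FC p f S ^ 2 / (p * (1 - p)) ^ S.card) - Infl p f / m ≤
      PE (fun _ => w4 p m) (fun a => f (Yc a) * gT p f (Tc F a)) := by
  have h1' : p < 1 := by linarith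
  have hm0 : 0 < m := by linarith
  have hm1 : 1 / m ≤ 1 := by rw [div_le_one hm0]; exact hm.le
  have hm2 : 0 ≤ 1 / m := by positivity
  have hq : 0 ≤ m * p := by positivity
  have f0 : ∀ r, 0 ≤ f r := fun r => by rcases hf r with h | h <;> rw [h]; norm_num
  have l1 := low h0 h1' hm hmp f F
  have l2 := hybrid h0 h1' hm hmp hf hmon F Finset.univ
  have e1 : PE (fun _ => w4 p m) (fun a => f (Yc a) * f (Zc F ∅ a)) =
      BE (m * p) (fun Om => BE (1 / m) (fun r => BE (1 / m) (fun r' =>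
        f (band Om r) * f (band Om ((Jset F Om).piecewise r r'))))) := by
    have := w4_E (V := V) p m (fun Om r r' _ => f (band Om r) * f (band Om ((Jset F Om).piecewise r r')))
    simp only [BE, PE_const (fun _ => bw_sum p)] at this ⊢
    rw [← this]
    congr 1; funext a
    congr 2
    funext x
    unfold Zc band
    by_cases hx : x ∈ Jset F (fun y => (a y).1)
    · have := Jset_sub hx
      simp [hx, this]
    · simp [hx]
  have e2 : PE (fun _ => w4 p m) (fun a => f (Yc a) * f (Zc F Finset.univ a)) ≤
      PE (fun _ => w4 p m) (fun a => f (Yc a) * gT p f (Tc F a)) := by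
    have a1 := w4_E (V := V) p m (fun Om r r' w => f (band Om r) * f (fun x => if x ∈ Jset F Om then r x else w x))
    have a2 := w4_E (V := V) p m (fun Om r r' w => f (band Om r) * gT p f ((Jset F Om).filter fun x => r x = true))
    refine (Eq.le (Eq.trans ?_ a1)).trans (LE.le.trans ?_ (Eq.ge a2))
    · congr 1; funext a
      congr 2
      funext x
      simp [Zc]
    refine BE_mono hq hmp fun Om => BE_mono hm2 hm1 fun r => BE_mono hm2 hm1 fun r' => ?_
    have : BE p (fun w : V → Bool => f (band Om r) * gT p f ((Jset F Om).filter fun x => r x = true)) =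
        BE p (fun w => f (band Om r) * f (fun x => decide (x ∈ (Jset F Om).filter fun x => r x = true) || w x)) := by
      unfold gT BE
      rw [PE_const (fun _ => bw_sum p), PE_mul_left]
    rw [this]
    refine BE_mono h0.le h1'.le fun w => mul_le_mul_of_nonneg_left (hmon ?_) (f0 _)
    intro x
    by_cases hx : x ∈ Jset F Om
    · simp [hx]; exact Bool.left_le_or _ _
    · simp [hx]
  have e3 : ∑ x, p / m * PE (fun _ => w4 p m) (fun a => Dx f x (Yc a)) ≤ Infl p f / m := by
    have : ∀ x, PE (fun _ => w4 p m) (fun a => Dx f x (Yc a)) = BE p (Dx f x) := fun x => PE_Yc hm (Dx f x)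
    simp only [this]
    rw [← Finset.mul_sum, Infl_eq hf hmon]
    have hs : 0 ≤ ∑ x, BE p (Dx f x) := Finset.sum_nonneg fun x _ =>
      PE_nonneg (fun _ => bw_nonneg h0.le h1'.le) fun r => Dx_nonneg hmon x r
    rw [div_mul_eq_mul_div]
    gcongr
    nlinarith
  rw [e1] at l2
  linarith

end Fsec

/-! ### Generic theorem -/

lemma Jset_card_le {V : Type*} (F : Finset (Finset V)) (Om : V → Bool) :
    (Jset F Om).card ≤ ∑ S ∈ F.filter (fun S => ∀ y ∈ S, Om y = true), S.card :=
  Finset.card_biUnion_le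

section Gsec
variable {V : Type*} [Fintype V] [DecidableEq V]

def bigFam (p : ℝ) (f : (V → Bool) → ℝ) (k : ℕ) : Finset (Finset V) :=
  Finset.univ.filter fun S => S.card ≤ k ∧ ¬ (FC p f S / (p * (1 - p)) ^ S.card) ^ 2 < (1/2 : ℝ) ^ (18 * k ^ 2)

lemma fam_mass {p : ℝ} (h0 : 0 < p) (h1 : p < 1) {f : (V → Bool) → ℝ} (hf : ∀ r, f r = 0 ∨ f r = 1)
    {k : ℕ} (hk : 4 ≤ k) (hI : Infl p f ≤ k) :
    BE p f - Infl p f / (2 * k) - 1 / k ≤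
      ∑ S ∈ bigFam p f k, FC p f S ^ 2 / (p * (1 - p)) ^ S.card := by
  have t := tail_bound h0 h1 f (k := k) (by omega)
  have c := claimF' h0 h1 hf hk hI
  have P := parseval h0 h1 f
  have : BE p (fun r => f r ^ 2) = BE p f := by
    congr 1; funext r; rcases hf r with h | h <;> rw [h] <;> norm_num
  rw [this] at P
  have e : ∑ S : Finset V, FC p f S ^ 2 / (p * (1 - p)) ^ S.card =
      ∑ S : Finset V, (if k < S.card then FC p f S ^ 2 / (p * (1 - p)) ^ S.card else 0) +
      ∑ S : Finset V, (if S.card ≤ k ∧ (FC p f S / (p * (1 - p)) ^ S.card) ^ 2 < (1/2 : ℝ) ^ (18 * k ^ 2) then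
        FC p f S ^ 2 / (p * (1 - p)) ^ S.card else 0) +
      ∑ S ∈ bigFam p f k, FC p f S ^ 2 / (p * (1 - p)) ^ S.card := by
    rw [bigFam, Finset.sum_filter, ← Finset.sum_add_distrib, ← Finset.sum_add_distrib]
    refine Finset.sum_congr rfl fun S _ => ?_
    by_cases h1 : k < S.card
    · have : ¬ S.card ≤ k := by omega
      simp [h1, this]
    · have h2 : S.card ≤ k := by omega
      by_cases h3 : (FC p f S / (p * (1 - p)) ^ S.card) ^ 2 < (1/2 : ℝ) ^ (18 * k ^ 2)
      · simp only [h1, h2, h3]; simp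
      · simp only [h1, h2, h3]; simp
  rw [e] at P
  linarith

lemma fam_J {p m : ℝ} (h0 : 0 < p) (h1 : p ≤ 1 / 2) (hm : 1 < m) (hmp : m * p ≤ 1)
    {f : (V → Bool) → ℝ} (hf : ∀ r, f r = 0 ∨ f r = 1) {k : ℕ} :
    BE (m * p) (fun Om => ((Jset (bigFam p f k) Om).card : ℝ)) ≤ k * (2 * m) ^ k * 2 ^ (18 * k ^ 2) := by
  have h1' : p < 1 := by linarith
  have hw : 0 < p * (1 - p) := mul_pos h0 (by linarith)
  have hq : 0 ≤ m * p := by positivity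
  set F := bigFam p f k with hF
  have a1 : ∀ Om : V → Bool, ((Jset F Om).card : ℝ) ≤ ∑ S ∈ F, (k : ℝ) * ∏ x ∈ S, num (Om x) := by
    intro Om
    have : (Jset F Om).card ≤ ∑ S ∈ F.filter (fun S => ∀ y ∈ S, Om y = true), S.card := by
      refine (Jset_card_le F Om).trans (le_of_eq ?_)
      exact Finset.sum_congr (by congr) fun _ _ => rfl
    calc ((Jset F Om).card : ℝ) ≤ ((∑ S ∈ F.filter (fun S => ∀ y ∈ S, Om y = true), S.card : ℕ) : ℝ) := by
          exact_mod_cast this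
      _ = ∑ S ∈ F, if ∀ y ∈ S, Om y = true then (S.card : ℝ) else 0 := by
          push_cast; rw [Finset.sum_filter]
      _ ≤ _ := by
          refine Finset.sum_le_sum fun S hS => ?_
          rw [num_prod]
          simp only [hF, bigFam, Finset.mem_filter] at hS
          split_ifs
          · rw [mul_one]; exact_mod_cast hS.2.1
          · simp
  have a2 := BE_mono hq hmp a1
  refine a2.trans ?_
  unfold BE
  rw [PE_sum]
  simp only [PE_mul_left]
  have a3 : ∀ S, PE (fun _ : V => bw (m * p)) (fun Om => ∏ x ∈ S, num (Om x)) = (m * p) ^ S.card :=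
    fun S => prob_sub (m * p) S
  simp only [a3]
  have a4 : ∀ S ∈ F, (k : ℝ) * (m * p) ^ S.card ≤
      (k * (2 * m) ^ k * 2 ^ (18 * k ^ 2)) * (FC p f S ^ 2 / (p * (1 - p)) ^ S.card) := by
    intro S hS
    simp only [hF, bigFam, Finset.mem_filter, not_lt] at hS
    have b1 := hS.2.2
    have b2 : (1/2 : ℝ) ^ (18 * k ^ 2) * (p * (1 - p)) ^ S.card ≤ FC p f S ^ 2 / (p * (1 - p)) ^ S.card := by
      have := mul_le_mul_of_nonneg_right b1 (by positivity : 0 ≤ (p * (1 - p)) ^ S.card)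
      refine this.trans_eq ?_
      field_simp
    have b3 : (m * p) ^ S.card ≤ (2 * m) ^ k * (p * (1 - p)) ^ S.card := by
      calc (m * p) ^ S.card ≤ ((2 * m) * (p * (1 - p))) ^ S.card := by
            refine pow_le_pow_left₀ hq ?_ _
            nlinarith [mul_pos (show 0 < m by linarith) h0]
        _ = (2 * m) ^ S.card * (p * (1 - p)) ^ S.card := mul_pow _ _ _
        _ ≤ _ := by
            gcongr
            · linarith
            · exact hS.2.1
    calc (k : ℝ) * (m * p) ^ S.card ≤ k * ((2 * m) ^ k * (p * (1 - p)) ^ S.card) := by gcongr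
      _ = (k * (2 * m) ^ k * 2 ^ (18 * k ^ 2)) * ((1/2 : ℝ) ^ (18 * k ^ 2) * (p * (1 - p)) ^ S.card) := by
          have : (2:ℝ) ^ (18 * k ^ 2) * (1/2) ^ (18 * k ^ 2) = 1 := by rw [← mul_pow]; norm_num
          linear_combination (-(k * ((2 * m) ^ k * (p * (1 - p)) ^ S.card))) * this
      _ ≤ _ := by gcongr
  refine (Finset.sum_le_sum a4).trans ?_
  rw [← Finset.mul_sum]
  refine mul_le_of_le_one_right (by positivity) ?_
  refine (Finset.sum_le_sum_of_subset_of_nonneg (Finset.subset_univ _) fun S _ _ => by positivity).trans ?_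
  rw [parseval h0 h1']
  refine BE_le_one h0.le h1'.le fun r => ?_
  rcases hf r with h | h <;> rw [h] <;> norm_num

lemma generic {p : ℝ} (h0 : 0 < p) {f : (V → Bool) → ℝ} (hf : ∀ r, f r = 0 ∨ f r = 1) (hmon : Monotone f)
    {k : ℕ} (hk : 4 ≤ k) (hkp : (k:ℝ) ^ 2 * p ≤ 1) (hI : Infl p f ≤ k) {δ A : ℝ} (hδ : 0 < δ) (hA : 0 < A) :
    BE p f - (2 / (k:ℝ) + Infl p f / (2 * (k:ℝ)) + Infl p f / (k:ℝ) ^ 2) / δ -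
      ((k:ℝ) * (2 * (k:ℝ) ^ 2) ^ k * 2 ^ (18 * k ^ 2)) / A ≤
    BE p (fun w => if ∃ T : Finset V, (∀ x ∈ T, w x = true) ∧ (T.card : ℝ) ≤ A ∧ 1 - δ ≤ gT p f T
      then (1:ℝ) else 0) := by
  set m : ℝ := (k:ℝ) ^ 2 with hm
  have hk' : (4:ℝ) ≤ k := by exact_mod_cast hk
  have hm1 : 1 < m := by nlinarith
  have hm16 : 16 ≤ m := by nlinarith
  have h1 : p ≤ 1 / 2 := by nlinarith
  have h1' : p < 1 := by linarith
  set F := bigFam p f k with hF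
  have q1 := pool_main h0 h1 hm1 hkp hf hmon F
  have q2 := fam_mass h0 h1' hf hk hI
  have q3 := fam_J (m := m) h0 h1 hm1 hkp hf (k := k)
  rw [← hF] at q2 q3
  have f0 : ∀ r, 0 ≤ f r := fun r => by rcases hf r with h | h <;> rw [h]; norm_num
  have f1 : ∀ r, f r ≤ 1 := fun r => by rcases hf r with h | h <;> rw [h]; norm_num
  have hw : 0 < p * (1 - p) := mul_pos h0 (by linarith)
  -- mass
  have r1 : ∑ S ∈ F, FC p f S ^ 2 / (p * (1 - p)) ^ S.card ≤ 1 := by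
    refine (Finset.sum_le_sum_of_subset_of_nonneg (Finset.subset_univ _) fun S _ _ => by positivity).trans ?_
    rw [parseval h0 h1']
    refine BE_le_one h0.le h1'.le fun r => ?_
    rcases hf r with h | h <;> rw [h] <;> norm_num
  have r2 : ∑ S ∈ F, FC p f S ^ 2 / (p * (1 - p)) ^ S.card - 1 / (k:ℝ) ≤
      ∑ S ∈ F, (1 - 1 / m) ^ S.card * (FC p f S ^ 2 / (p * (1 - p)) ^ S.card) := by
    have : ∀ S ∈ F, (1 - 1 / (k:ℝ)) * (FC p f S ^ 2 / (p * (1 - p)) ^ S.card) ≤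
        (1 - 1 / m) ^ S.card * (FC p f S ^ 2 / (p * (1 - p)) ^ S.card) := by
      intro S hS
      refine mul_le_mul_of_nonneg_right ?_ (by positivity)
      simp only [hF, bigFam, Finset.mem_filter, not_lt] at hS
      have hc : (S.card : ℝ) ≤ k := by exact_mod_cast hS.2.1
      have hm' : 1 / m ≤ 1 := by rw [div_le_one (by linarith)]; linarith
      have b := one_add_mul_le_pow (a := -(1 / m)) (by linarith) S.card
      have : (S.card : ℝ) * (1 / m) ≤ k * (1 / m) := by gcongr
      have e : (k:ℝ) * (1 / m) = 1 / k := by rw [hm]; field_simp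
      rw [← sub_eq_add_neg] at b
      linarith
    have := Finset.sum_le_sum this
    rw [← Finset.mul_sum] at this
    have h3 : 1 / (k:ℝ) * ∑ S ∈ F, FC p f S ^ 2 / (p * (1 - p)) ^ S.card ≤ 1 / k :=
      mul_le_of_le_one_right (by positivity) r1
    linarith
  set ev : (V → Bool) → ℝ := fun w => if ∃ T : Finset V, (∀ x ∈ T, w x = true) ∧ (T.card : ℝ) ≤ A ∧ 1 - δ ≤ gT p f T
      then 1 else 0 with hev
  have key : ∀ a : V → B4, f (Yc a) - (f (Yc a) - f (Yc a) * gT p f (Tc F a)) * (1 / δ) -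
      ((Jset F (fun y => (a y).1)).card : ℝ) * (1 / A) ≤ ev (Yc a) := by
    intro a
    have g1 : gT p f (Tc F a) ≤ 1 := BE_le_one h0.le h1'.le fun r => f1 _
    have ev0 : 0 ≤ ev (Yc a) := by simp only [hev]; split_ifs <;> norm_num
    have j0 : 0 ≤ ((Jset F (fun y => (a y).1)).card : ℝ) * (1 / A) := by positivity
    rcases hf (Yc a) with h | h
    · rw [h]; simp; rw [← one_div]; linarith
    · rw [h]
      have d0 : 0 ≤ (1 - gT p f (Tc F a)) * (1 / δ) := mul_nonneg (by linarith) (by positivity)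
      by_cases hT : 1 - δ ≤ gT p f (Tc F a)
      · by_cases hJ : ((Jset F (fun y => (a y).1)).card : ℝ) ≤ A
        · have : ev (Yc a) = 1 := by
            simp only [hev]
            refine if_pos ⟨Tc F a, fun x hx => ?_, ?_, hT⟩
            · rw [Tc, Finset.mem_filter] at hx
              have h2 := Jset_sub hx.1
              simp [Yc, hx.2, h2]
            · refine le_trans ?_ hJ
              exact_mod_cast Finset.card_filter_le _ _
          rw [this]; linarith
        · have : 1 ≤ ((Jset F (fun y => (a y).1)).card : ℝ) * (1 / A) := by
            rw [mul_one_div, le_div_iff₀ hA]; linarith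
          linarith
      · have : 1 ≤ (1 - gT p f (Tc F a)) * (1 / δ) := by
          rw [mul_one_div, le_div_iff₀ hδ]; linarith
        linarith
  have fin := PE_mono (μ := fun _ : V => w4 p m) (fun _ => w4_nonneg h0 h1' hm1 hkp) key
  rw [PE_sub, PE_sub, PE_mul_right, PE_mul_right, PE_sub, PE_Yc hm1 f, PE_Yc hm1 ev] at fin
  have eJ : PE (fun _ : V => w4 p m) (fun a => ((Jset F (fun y => (a y).1)).card : ℝ)) =
      BE (m * p) (fun Om => ((Jset F Om).card : ℝ)) := by
    have := w4_E (V := V) p m (fun Om _ _ _ => ((Jset F Om).card : ℝ))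
    simp only [BE, PE_const (fun _ => bw_sum _)] at this
    exact this
  rw [eJ] at fin
  have u1 : (BE p f - PE (fun _ : V => w4 p m) (fun a => f (Yc a) * gT p f (Tc F a))) * (1 / δ) ≤
      (2 / k + Infl p f / (2 * k) + Infl p f / m) / δ := by
    rw [mul_one_div]
    gcongr
    have : (2:ℝ) / k = 1 / k + 1 / k := by ring
    linarith
  have u2 : BE (m * p) (fun Om : V → Bool => ((Jset F Om).card : ℝ)) * (1 / A) ≤
      (k * (2 * m) ^ k * 2 ^ (18 * k ^ 2)) / A := by
    rw [mul_one_div]; gcongr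
  linarith

end Gsec

/-! ### Facts on the frozen objects -/

lemma bWeight_eq {N : ℕ} (p : ℝ) (ω : Cube N → Bool) : bWeight p ω = ∏ x, bw p (ω x) := by
  unfold bWeight bw
  rw [Finset.prod_ite, Finset.prod_const, Finset.prod_const]
  congr 3
  ext x; simp

def indS {α : Type*} (E : Set α) (ω : α) : ℝ := if ω ∈ E then 1 else 0

def fE {N : ℕ} (κ : ℝ) (ω : Cube N → Bool) : ℝ := indS (emptyInter κ) ω

lemma bernoulliP_eq {N : ℕ} (p : ℝ) (E : Set (Cube N → Bool)) :
    bernoulliP p E = BE p (indS E) := by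
  unfold bernoulliP BE PE
  refine Finset.sum_congr rfl fun ω _ => ?_
  rw [bWeight_eq]
  by_cases h : ω ∈ E <;> simp [indS, h]

lemma indS_congr {α β : Type*} {E : Set α} {F : Set β} {a : α} {b : β} (h : a ∈ E ↔ b ∈ F) :
    indS E a = indS F b := by
  unfold indS
  by_cases h1 : a ∈ E
  · rw [if_pos h1, if_pos (h.1 h1)]
  · rw [if_neg h1, if_neg (fun h2 => h1 (h.2 h2))]

lemma influence_eq {N : ℕ} (κ p : ℝ) : influence (N := N) κ p = Infl p (fE (N := N) κ) := by
  unfold influence Infl BE PE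
  refine Finset.sum_congr rfl fun x _ => Finset.sum_congr rfl fun ω _ => ?_
  rw [Finset.mul_sum]
  refine Finset.sum_congr rfl fun b _ => ?_
  rw [bWeight_eq, ← mul_assoc]
  congr 1
  by_cases h1 : ω ∈ emptyInter κ <;> by_cases h2 : Function.update ω x b ∈ emptyInter κ <;>
    simp [fE, indS, h1, h2]

lemma fE_01 {N : ℕ} (κ : ℝ) (ω : Cube N → Bool) : fE κ ω = 0 ∨ fE κ ω = 1 := by
  unfold fE indS; split_ifs <;> simp

lemma mem_emptyInter {N : ℕ} (κ : ℝ) (ω : Cube N → Bool) :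
    ω ∈ emptyInter κ ↔ ∀ y : Cube N, ∃ x, ω x = true ∧ y ∉ halfCube κ x := by
  unfold emptyInter
  constructor
  · intro h y
    by_contra hc
    push Not at hc
    have h' : (⋂ x ∈ {x : Cube N | ω x = true}, halfCube κ x) = (∅ : Set (Cube N)) := h
    have : y ∈ (∅ : Set (Cube N)) := by
      rw [← h']
      exact Set.mem_iInter₂.2 fun x hx => hc x hx
    exact this
  · intro h
    have h' : (⋂ x ∈ {x : Cube N | ω x = true}, halfCube κ x) = (∅ : Set (Cube N)) := by
      refine Set.eq_empty_iff_forall_notMem.2 fun y hy => ?_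
      obtain ⟨x, hx, hyx⟩ := h y
      exact hyx (Set.mem_iInter₂.1 hy x hx)
    exact h'

lemma fE_mono {N : ℕ} (κ : ℝ) : Monotone (fE (N := N) κ) := by
  intro a b hab
  unfold fE indS
  by_cases h : a ∈ emptyInter κ
  · have : b ∈ emptyInter κ := by
      rw [mem_emptyInter] at h ⊢
      intro y
      obtain ⟨x, hx, hy⟩ := h y
      refine ⟨x, ?_, hy⟩
      have := hab x
      rw [hx] at this
      exact this rfl
    simp [h, this]
  · simp only [h, if_false]; split_ifs <;> norm_num

lemma boost_iff {N : ℕ} (κ p δ : ℝ) (T : Finset (Cube N)) :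
    PerceptronBoosting κ p δ T ↔ 1 - δ ≤ gT p (fE κ) T := by
  unfold PerceptronBoosting gT
  rw [bernoulliP_eq, ge_iff_le]
  have : indS {ω : Cube N → Bool |
        ((⋂ x ∈ {x : Cube N | ω x = true}, halfCube κ x) ∩ ⋂ x ∈ T, halfCube κ x) =
          (∅ : Set (Cube N))} =
      fun w => fE κ (fun x => decide (x ∈ T) || w x) := by
    funext w
    refine indS_congr ?_
    rw [mem_emptyInter]
    change ((⋂ x ∈ {x : Cube N | w x = true}, halfCube κ x) ∩ ⋂ x ∈ T, halfCube κ x) =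
          (∅ : Set (Cube N)) ↔ _
    rw [Set.eq_empty_iff_forall_notMem]
    refine forall_congr' fun y => ?_
    rw [Set.mem_inter_iff, Set.mem_iInter₂, Set.mem_iInter₂]
    simp only [Bool.or_eq_true, decide_eq_true_eq]
    constructor
    · intro h
      by_contra hc
      push Not at hc
      exact h ⟨fun x hx => hc x (Or.inr hx), fun x hx => hc x (Or.inl hx)⟩
    · rintro ⟨x, h | h, hy⟩ ⟨h1, h2⟩
      · exact hy (h2 x h)
      · exact hy (h1 x h)
  rw [this]

lemma BE_cont {V : Type*} [Fintype V] [DecidableEq V] {G : ℝ → (V → Bool) → ℝ}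
    (hG : ∀ r, Continuous fun p => G p r) : Continuous fun p => BE p (G p) := by
  unfold BE PE
  refine continuous_finsetSum _ fun a _ => Continuous.mul ?_ (hG a)
  refine continuous_finsetProd _ fun x _ => ?_
  unfold bw
  beta_reduce
  split_ifs <;> fun_prop

lemma Infl_cont {V : Type*} [Fintype V] [DecidableEq V] (f : (V → Bool) → ℝ) :
    Continuous fun p => Infl p f := by
  unfold Infl
  refine continuous_finsetSum _ fun x _ => BE_cont fun r => ?_
  refine continuous_finsetSum _ fun b _ => ?_
  unfold bw
  split_ifs <;> fun_prop

lemma BE_at_one {V : Type*} [Fintype V] [DecidableEq V] (G : (V → Bool) → ℝ) :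
    BE 1 G = G (fun _ => true) := by
  unfold BE PE
  rw [Finset.sum_eq_single (fun _ => true)]
  · simp [bw]
  · intro b _ hb
    have : ∃ x, b x = false := by
      by_contra h
      push Not at h
      exact hb (funext fun x => by simpa using h x)
    obtain ⟨x, hx⟩ := this
    rw [Finset.prod_eq_zero (Finset.mem_univ x) (by simp [bw, hx]), zero_mul]
  · simp

lemma BE_at_zero {V : Type*} [Fintype V] [DecidableEq V] (G : (V → Bool) → ℝ) :
    BE 0 G = G (fun _ => false) := by
  unfold BE PE
  rw [Finset.sum_eq_single (fun _ => false)]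
  · simp [bw]
  · intro b _ hb
    have : ∃ x, b x = true := by
      by_contra h
      push Not at h
      exact hb (funext fun x => by simpa using h x)
    obtain ⟨x, hx⟩ := this
    rw [Finset.prod_eq_zero (Finset.mem_univ x) (by simp [bw, hx]), zero_mul]
  · simp

lemma Infl_at_one {V : Type*} [Fintype V] [DecidableEq V] (f : (V → Bool) → ℝ) : Infl 1 f = 0 := by
  unfold Infl
  refine Finset.sum_eq_zero fun x _ => ?_
  rw [BE_at_one]
  simp [bw]

lemma BE_mono_p {V : Type*} [Fintype V] [DecidableEq V] {f : (V → Bool) → ℝ} (hf : Monotone f)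
    {p q : ℝ} (h0 : 0 ≤ p) (hpq : p ≤ q) (h1 : q ≤ 1) : BE p f ≤ BE q f := by
  let μ : Bool × Bool → ℝ := fun v =>
    if v.1 then (if v.2 then p else 0) else (if v.2 then q - p else 1 - q)
  have e1 : PE (fun _ : V => μ) (fun a => f (fun x => (a x).1)) = BE p f :=
    PE_push' (μ := fun _ : V => μ) (ν := fun _ => bw p) (fun _ v => v.1) f fun x b => by
      cases b <;> simp [Fintype.sum_prod_type, μ, bw]
  have e2 : PE (fun _ : V => μ) (fun a => f (fun x => (a x).2)) = BE q f :=
    PE_push' (μ := fun _ : V => μ) (ν := fun _ => bw q) (fun _ v => v.2) f fun x b => by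
      cases b <;> simp [Fintype.sum_prod_type, μ, bw]
  rw [← e1, ← e2]
  unfold PE
  refine Finset.sum_le_sum fun a _ => ?_
  by_cases h : ∀ x, (a x).1 ≤ (a x).2
  · refine mul_le_mul_of_nonneg_left (hf h) (Finset.prod_nonneg fun x _ => ?_)
    simp only [μ]
    split_ifs <;> linarith
  · push Not at h
    obtain ⟨x, hx⟩ := h
    have : ∏ x, μ (a x) = 0 := by
      refine Finset.prod_eq_zero (Finset.mem_univ x) ?_
      revert hx
      rcases a x with ⟨_ | _, _ | _⟩ <;> simp [μ]
    simp [this]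

lemma pStar_facts {N : ℕ} {κ pN ε : ℝ} (hL : 0 ≤ Real.log (Real.log N)) (h0 : 0 ≤ pN) (h1 : pN ≤ 1)
    (hε : 0 < ε) (hP : bernoulliP pN (emptyInter (N := N) κ) = ε) :
    0 < pStar (N := N) κ pN ∧ pStar (N := N) κ pN ≤ 1 ∧
    Infl (pStar (N := N) κ pN) (fE (N := N) κ) ≤ 8 * Real.log (Real.log N) ^ ((1 : ℝ) / 10) ∧
    ε ≤ BE (pStar (N := N) κ pN) (fE (N := N) κ) := by
  set S := {p : ℝ | pN ≤ p ∧ influence (N := N) κ p ≤ 8 * Real.log (Real.log N) ^ ((1 : ℝ) / 10)} with hS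
  have hSc : IsClosed S := by
    simp only [hS, influence_eq]
    exact (isClosed_le continuous_const continuous_id).inter (isClosed_le (Infl_cont _) continuous_const)
  have h1S : (1:ℝ) ∈ S := by
    refine ⟨h1, ?_⟩
    rw [influence_eq, Infl_at_one]
    positivity
  have hb : BddBelow S := ⟨pN, fun p hp => hp.1⟩
  have hm : pStar (N := N) κ pN ∈ S := hSc.csInf_mem ⟨1, h1S⟩ hb
  have hle : pStar (N := N) κ pN ≤ 1 := csInf_le hb h1S
  have hP' : BE pN (fE (N := N) κ) = ε := by rw [← hP, bernoulliP_eq]; rfl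
  have hge : ε ≤ BE (pStar (N := N) κ pN) (fE (N := N) κ) := by
    rw [← hP']
    exact BE_mono_p (fE_mono κ) h0 hm.1 hle
  refine ⟨?_, hle, ?_, hge⟩
  · rcases (h0.trans hm.1).lt_or_eq with h | h
    · exact h
    · exfalso
      rw [← h, BE_at_zero] at hge
      have : fE (N := N) κ (fun _ => false) = 0 := by
        have h : ¬ (fun _ : Cube N => false) ∈ emptyInter (N := N) κ := by
          rw [mem_emptyInter]
          simp
        unfold fE indS
        rw [if_neg h]
      linarith
  · rw [← influence_eq]; exact hm.2

/-! ### Numerics and edge cases -/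

lemma num_bound {k : ℕ} : (k:ℝ) ^ 2 * ((k:ℝ) * (2 * (k:ℝ) ^ 2) ^ k * 2 ^ (18 * k ^ 2)) ≤
    Real.exp (24 * (k:ℝ) ^ 2) := by
  rcases Nat.eq_zero_or_pos k with h | hk
  · subst h; simp
  have h1 : (k:ℝ) ≤ 2 ^ k := by exact_mod_cast Nat.lt_two_pow_self.le
  have hk1 : k ≤ k ^ 2 := by nlinarith
  have h2 : (2:ℝ) * (k:ℝ) ^ 2 ≤ 2 ^ (3 * k) := by
    calc (2:ℝ) * (k:ℝ) ^ 2 ≤ 2 ^ k * (2 ^ k) ^ 2 := by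
          gcongr
          calc (2:ℝ) = 2 ^ 1 := by norm_num
            _ ≤ 2 ^ k := by gcongr; norm_num; exact hk
      _ = 2 ^ (3 * k) := by ring
  have h3 : (k:ℝ) ^ 3 ≤ 2 ^ (3 * k ^ 2) := by
    calc (k:ℝ) ^ 3 ≤ (2 ^ k) ^ 3 := by gcongr
      _ = 2 ^ (3 * k) := by ring
      _ ≤ _ := by gcongr; norm_num
  calc (k:ℝ) ^ 2 * ((k:ℝ) * (2 * (k:ℝ) ^ 2) ^ k * 2 ^ (18 * k ^ 2))
      = (k:ℝ) ^ 3 * (2 * (k:ℝ) ^ 2) ^ k * 2 ^ (18 * k ^ 2) := by ring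
    _ ≤ 2 ^ (3 * k ^ 2) * (2 ^ (3 * k)) ^ k * 2 ^ (18 * k ^ 2) := by gcongr
    _ = 2 ^ (24 * k ^ 2) := by rw [← pow_mul, ← pow_add, ← pow_add]; congr 1; ring
    _ ≤ (Real.exp 1) ^ (24 * k ^ 2) := by
        gcongr
        have := Real.add_one_le_exp (1:ℝ)
        linarith
    _ = Real.exp (24 * (k:ℝ) ^ 2) := by
        rw [← Real.exp_nat_mul]; push_cast; ring_nf

def badSet {N : ℕ} (κ : ℝ) (y : Cube N) : Finset (Cube N) :=
  Finset.univ.filter fun x => y ∉ halfCube κ x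

lemma bad_card {N q : ℕ} {κ : ℝ} (hq : 4 * q ≤ N) (hκ : 4 * κ ^ 2 < N) (y : Cube N) :
    2 ^ q ≤ (badSet κ y).card := by
  let e : (Fin q → Bool) → Cube N := fun g i => if h : (i:ℕ) < q then g ⟨i, h⟩ else !(y i)
  have he : Function.Injective e := by
    intro g g' h
    funext j
    have := congrFun h ⟨j, by omega⟩
    simpa [e] using this
  have h1 : (Finset.univ.image e) ⊆ badSet κ y := by
    intro x hx
    obtain ⟨g, -, rfl⟩ := Finset.mem_image.1 hx
    unfold badSet
    refine Finset.mem_filter.2 ⟨Finset.mem_univ _, ?_⟩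
    intro hy
    have hy' : κ * Real.sqrt N ≤ cubeDot (e g) y := hy
    have hd : cubeDot (e g) y ≤ 2 * (q:ℝ) - N := by
      unfold cubeDot
      have : ∀ i : Fin N, pmVal (e g i) * pmVal (y i) ≤ (if (i:ℕ) < q then 2 else 0) - 1 := by
        intro i
        by_cases h : (i:ℕ) < q
        · simp only [e, h]
          simp only [dif_pos, if_true]
          cases g ⟨i, h⟩ <;> cases y i <;> simp [pmVal] <;> norm_num
        · simp only [e, h]
          cases y i <;> simp [pmVal]
      refine (Finset.sum_le_sum fun i _ => this i).trans ?_
      rw [Finset.sum_sub_distrib, ← Finset.sum_filter, Finset.sum_const, Finset.sum_const]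
      have hc : (Finset.univ.filter fun i : Fin N => (i:ℕ) < q).card ≤ q := by
        calc (Finset.univ.filter fun i : Fin N => (i:ℕ) < q).card ≤ (Finset.range q).card :=
              Finset.card_le_card_of_injOn (fun i => (i:ℕ)) (fun i hi => by simpa using hi)
                (fun a _ b _ h => Fin.ext h)
          _ = q := Finset.card_range q
      have hc' : ((Finset.univ.filter fun i : Fin N => (i:ℕ) < q).card : ℝ) ≤ q := by exact_mod_cast hc
      simp
      linarith
    have hq' : 4 * (q:ℝ) ≤ N := by exact_mod_cast hq
    have hs : Real.sqrt N ^ 2 = N := Real.sq_sqrt (by positivity)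
    have hs0 : 0 ≤ Real.sqrt N := Real.sqrt_nonneg _
    have hs1 : |2 * κ| < Real.sqrt N := by
      refine abs_lt_of_sq_lt_sq ?_ hs0
      rw [hs]; linarith
    have := (abs_lt.1 hs1).1
    nlinarith
  calc 2 ^ q = (Finset.univ.image e).card := by
        rw [Finset.card_image_of_injective _ he]; simp
    _ ≤ _ := Finset.card_le_card h1

lemma avoid_prob {V : Type*} [Fintype V] [DecidableEq V] (p : ℝ) (B : Finset V) :
    BE p (fun w : V → Bool => ∏ x, (if x ∈ B ∧ w x = true then (0:ℝ) else 1)) = (1 - p) ^ B.card := by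
  unfold BE
  have := PE_prod (fun _ : V => bw p) (fun x b => if x ∈ B ∧ b = true then (0:ℝ) else 1)
  rw [this]
  have : ∀ x, ∑ v, bw p v * (if x ∈ B ∧ v = true then (0:ℝ) else 1) = if x ∈ B then 1 - p else 1 := by
    intro x
    by_cases h : x ∈ B <;> simp [bw, h]
  simp only [this]
  rw [Finset.prod_ite_mem, Finset.univ_inter, Finset.prod_const]

lemma big_p {N q : ℕ} {κ p : ℝ} (hq : 4 * q ≤ N) (hκ : 4 * κ ^ 2 < N) (h0 : 0 ≤ p) (h1 : p ≤ 1) :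
    1 - 2 ^ N * (1 - p) ^ (2 ^ q) ≤ BE p (fE (N := N) κ) := by
  have a : ∀ w : Cube N → Bool, 1 - fE κ w ≤
      ∑ y : Cube N, ∏ x, (if x ∈ badSet κ y ∧ w x = true then (0:ℝ) else 1) := by
    intro w
    have nn : ∀ y : Cube N, 0 ≤ ∏ x, (if x ∈ badSet κ y ∧ w x = true then (0:ℝ) else 1) :=
      fun y => Finset.prod_nonneg fun x _ => by split_ifs <;> norm_num
    by_cases h : w ∈ emptyInter κ
    · have : fE κ w = 1 := by unfold fE indS; rw [if_pos h]
      rw [this]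
      simpa using Finset.sum_nonneg fun y _ => nn y
    · have : fE κ w = 0 := by unfold fE indS; rw [if_neg h]
      rw [this]
      rw [mem_emptyInter] at h
      push Not at h
      obtain ⟨y, hy⟩ := h
      refine le_trans ?_ (Finset.single_le_sum (fun y _ => nn y) (Finset.mem_univ y))
      rw [Finset.prod_eq_one]
      · norm_num
      · intro x _
        refine if_neg ?_
        rintro ⟨hb, hw⟩
        exact (Finset.mem_filter.1 hb).2 (hy x hw)
  have b := BE_mono h0 h1 a
  unfold BE at b
  rw [PE_sub, PE_const (fun _ => bw_sum p), PE_sum] at b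
  have c : ∀ y : Cube N, PE (fun _ : Cube N => bw p)
      (fun w => ∏ x, (if x ∈ badSet κ y ∧ w x = true then (0:ℝ) else 1)) ≤ (1 - p) ^ (2 ^ q) := by
    intro y
    refine (avoid_prob p (badSet κ y)).le.trans ?_
    exact pow_le_pow_of_le_one (by linarith) (by linarith) (bad_card hq hκ y)
  have d := Finset.sum_le_sum (s := Finset.univ) fun y _ => c y
  rw [Finset.sum_const] at d
  simp at d
  unfold BE
  linarith

lemma growth : ∀ᶠ N : ℕ in Filter.atTop, 33282 * (N:ℝ) ^ 5 ≤ 2 ^ (N / 4) := by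
  have h := tendsto_pow_const_div_const_pow_of_one_lt 5 (r := (2:ℝ)) (by norm_num)
  have h2 := h.eventually (ge_mem_nhds (show (0:ℝ) < 1 / (33282 * 8 ^ 5) by norm_num))
  have h3 : Filter.Tendsto (fun N : ℕ => N / 4) Filter.atTop Filter.atTop :=
    Nat.tendsto_div_const_atTop (by norm_num)
  filter_upwards [h3.eventually h2, Filter.eventually_ge_atTop 4] with N hN h4
  have hm : N ≤ 8 * (N / 4) := by omega
  have hm' : (N:ℝ) ≤ 8 * ((N / 4 : ℕ) : ℝ) := by exact_mod_cast hm
  rw [div_le_iff₀ (by positivity)] at hN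
  calc 33282 * (N:ℝ) ^ 5 ≤ 33282 * (8 * ((N / 4 : ℕ) : ℝ)) ^ 5 := by gcongr
    _ = (33282 * 8 ^ 5) * ((N / 4 : ℕ) : ℝ) ^ 5 := by ring
    _ ≤ (33282 * 8 ^ 5) * (1 / (33282 * 8 ^ 5) * 2 ^ (N / 4)) := by gcongr
    _ = _ := by ring

lemma big_p' {N : ℕ} {κ p : ℝ} (hN : 1 ≤ N) (hg : 33282 * (N:ℝ) ^ 5 ≤ 2 ^ (N / 4)) (hκ : 4 * κ ^ 2 < N)
    (h1 : p ≤ 1) (hp : 1 / (16641 * (N:ℝ) ^ 4) ≤ p) : 1 - 1 / (N:ℝ) ≤ BE p (fE (N := N) κ) := by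
  have hN' : (1:ℝ) ≤ N := by exact_mod_cast hN
  have h0 : 0 ≤ p := le_trans (by positivity) hp
  refine le_trans ?_ (big_p (q := N / 4) (by omega) hκ h0 h1)
  have a1 : (1 - p) ^ (2 ^ (N / 4)) ≤ Real.exp (-(2 * N)) := by
    calc (1 - p) ^ (2 ^ (N / 4)) ≤ (Real.exp (-p)) ^ (2 ^ (N / 4)) := by
          refine pow_le_pow_left₀ (by linarith) ?_ _
          have := Real.add_one_le_exp (-p)
          linarith
      _ = Real.exp (-(2 ^ (N / 4) * p)) := by
          rw [← Real.exp_nat_mul]; push_cast; ring_nf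
      _ ≤ _ := by
          rw [Real.exp_le_exp]
          have : 33282 * (N:ℝ) ^ 5 * (1 / (16641 * (N:ℝ) ^ 4)) ≤ 2 ^ (N / 4) * p := by gcongr
          have e : 33282 * (N:ℝ) ^ 5 * (1 / (16641 * (N:ℝ) ^ 4)) = 2 * N := by
            field_simp; norm_num
          linarith
  have a2 : (N:ℝ) * 2 ^ N ≤ Real.exp (2 * N) := by
    have h1 : (N:ℝ) ≤ 2 ^ N := by exact_mod_cast Nat.lt_two_pow_self.le
    have h2 : (2:ℝ) ^ N ≤ Real.exp N := by
      rw [← Real.exp_one_pow]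
      gcongr
      have := Real.add_one_le_exp (1:ℝ)
      linarith
    calc (N:ℝ) * 2 ^ N ≤ Real.exp N * Real.exp N := by
          refine mul_le_mul (h1.trans h2) h2 (by positivity) (by positivity)
      _ = _ := by rw [← Real.exp_add]; ring_nf
  have a3 : 2 ^ N * (1 - p) ^ (2 ^ (N / 4)) ≤ 1 / (N:ℝ) := by
    rw [le_div_iff₀ (by linarith)]
    calc 2 ^ N * (1 - p) ^ (2 ^ (N / 4)) * (N:ℝ) ≤ 2 ^ N * Real.exp (-(2 * N)) * N := by gcongr
      _ = (N * 2 ^ N) * Real.exp (-(2 * N)) := by ring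
      _ ≤ Real.exp (2 * N) * Real.exp (-(2 * N)) := by gcongr
      _ = 1 := by rw [← Real.exp_add]; simp
  linarith

set_option maxHeartbeats 1600000 in
lemma core {N : ℕ} {κ a ε δ p : ℝ} (hN : 1 ≤ N) (hg : 33282 * (N:ℝ) ^ 5 ≤ 2 ^ (N / 4)) (hκ : 4 * κ ^ 2 < N)
    (ha : 1 ≤ a) (haN : a ^ 2 ≤ N) (hε : a⁻¹ ≤ ε) (hε1 : ε < 1) (hδ : 0 < δ) (hδ1 : δ < 1)
    (h0 : 0 < p) (h1 : p ≤ 1) (hI : Infl p (fE (N := N) κ) ≤ 8 * a) (hE : ε ≤ BE p (fE (N := N) κ)) :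
    ε / 2 ≤ BE p (fun ω : Cube N → Bool => if ∃ T : Finset (Cube N), (∀ x ∈ T, ω x = true) ∧
      (T.card : ℝ) ≤ Real.exp (10 ^ 15 * (a / (δ * ε)) ^ 2) ∧ 1 - δ ≤ gT p (fE κ) T then (1:ℝ) else 0) := by
  have hN' : (1:ℝ) ≤ N := by exact_mod_cast hN
  have ha0 : 0 < a := by linarith
  have hε0 : 0 < ε := lt_of_lt_of_le (by positivity) hε
  have hD : 0 < δ * ε := by positivity
  have hDδ : δ * ε ≤ δ := by nlinarith
  set R := a / (δ * ε) with hR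
  have hR1 : 1 ≤ R := by
    rw [hR, le_div_iff₀ hD]; nlinarith
  set A := Real.exp (10 ^ 15 * R ^ 2) with hA
  by_cases c1 : δ < 1 / N
  · -- tiny delta
    have r1 : (N:ℝ) ≤ R := by
      rw [lt_div_iff₀ (by linarith)] at c1
      rw [hR, le_div_iff₀ hD]
      nlinarith
    refine le_trans (by linarith : ε / 2 ≤ BE p (fE (N := N) κ)) ?_
    refine BE_mono h0.le h1 fun w => ?_
    rcases fE_01 κ w with h | h
    · rw [h]; split_ifs <;> norm_num
    · rw [h, if_pos]
      refine ⟨Finset.univ.filter fun x => w x = true, fun x hx => (Finset.mem_filter.1 hx).2, ?_, ?_⟩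
      · have b1 : (Finset.univ.filter fun x : Cube N => w x = true).card ≤ 2 ^ N :=
          (Finset.card_le_univ _).trans (by simp)
        have b2 : (((Finset.univ.filter fun x : Cube N => w x = true).card : ℕ) : ℝ) ≤ 2 ^ N := by
          exact_mod_cast b1
        refine b2.trans ?_
        have h2 : (2:ℝ) ^ N ≤ Real.exp N := by
          rw [← Real.exp_one_pow]
          gcongr
          have := Real.add_one_le_exp (1:ℝ)
          linarith
        refine h2.trans ?_
        rw [hA, Real.exp_le_exp]
        nlinarith
      · have : gT p (fE κ) (Finset.univ.filter fun x : Cube N => w x = true) = 1 := by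
          unfold gT
          have e : ∀ w' : Cube N → Bool, fE κ (fun x =>
              decide (x ∈ Finset.univ.filter fun x : Cube N => w x = true) || w' x) = 1 := by
            intro w'
            have m : fE κ w ≤ fE κ (fun x =>
                decide (x ∈ Finset.univ.filter fun x : Cube N => w x = true) || w' x) := by
              refine fE_mono κ fun x => ?_
              cases hx : w x <;> simp [hx]
            rw [h] at m
            rcases fE_01 κ (fun x =>
                decide (x ∈ Finset.univ.filter fun x : Cube N => w x = true) || w' x) with h' | h'
            · rw [h'] at m; norm_num at m
            · exact h'
          simp only [e]
          exact PE_const (fun _ => bw_sum p) 1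
        rw [this]; linarith
  · push Not at c1
    set k := ⌈128 * R⌉₊ with hk
    have k1 : 128 * R ≤ k := Nat.le_ceil _
    have k2 : (k:ℝ) ≤ 129 * R := by
      have := Nat.ceil_lt_add_one (show 0 ≤ 128 * R by positivity)
      linarith
    have k128 : (128:ℝ) ≤ k := by linarith
    have k4 : 4 ≤ k := by
      have : (4:ℝ) ≤ k := by linarith
      exact_mod_cast this
    by_cases c2 : (k:ℝ) ^ 2 * p ≤ 1
    · have kK : a * 128 ≤ k * (δ * ε) := by
        have := mul_le_mul_of_nonneg_right k1 hD.le
        rw [hR, mul_assoc, div_mul_cancel₀ _ hD.ne'] at this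
        linarith
      have hI0 := Infl_nonneg h0.le h1 (fE (N := N) κ)
      have ak : a * 128 ≤ k := by nlinarith
      have g := generic (δ := δ) (A := A) h0 (fE_01 κ) (fE_mono κ) k4 c2 (by linarith) hδ (Real.exp_pos _)
      refine le_trans ?_ g
      have t1 : (2 / (k:ℝ) + Infl p (fE (N := N) κ) / (2 * (k:ℝ)) + Infl p (fE (N := N) κ) / (k:ℝ) ^ 2) / δ ≤
          ε / 4 := by
        rw [div_le_iff₀ hδ]
        have e1 : Infl p (fE (N := N) κ) / (2 * (k:ℝ)) ≤ (4 * a) / k := by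
          rw [div_le_div_iff₀ (by positivity) (by positivity)]; nlinarith
        have e2 : Infl p (fE (N := N) κ) / (k:ℝ) ^ 2 ≤ (8 * a) / k := by
          rw [div_le_div_iff₀ (by positivity) (by positivity)]
          nlinarith [mul_le_mul_of_nonneg_right hI (show (0:ℝ) ≤ k by positivity),
            mul_nonneg ha0.le (show (0:ℝ) ≤ k * (k - 1) by nlinarith)]
        have e3 : (2:ℝ) / k ≤ (2 * a) / k := by gcongr; linarith
        have e4 : (2 * a) / k + (4 * a) / k + (8 * a) / k ≤ ε / 4 * δ := by
          rw [← add_div, ← add_div, div_le_iff₀ (by positivity)]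
          linarith
        linarith
      have t2 : ((k:ℝ) * (2 * (k:ℝ) ^ 2) ^ k * 2 ^ (18 * k ^ 2)) / A ≤ ε / 4 := by
        have nb := num_bound (k := k)
        have hAk : Real.exp (24 * (k:ℝ) ^ 2) ≤ A := by
          rw [hA, Real.exp_le_exp]
          have : (k:ℝ) ^ 2 ≤ (129 * R) ^ 2 := by gcongr
          nlinarith [sq_nonneg R]
        have hεk : 1 ≤ ε / 4 * (k:ℝ) ^ 2 := by
          have : 1 ≤ ε * a := by
            rw [inv_le_iff_one_le_mul₀ ha0] at hε
            linarith
          have h3 : 1 * 128 ≤ ε * k := by nlinarith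
          nlinarith
        rw [div_le_iff₀ (Real.exp_pos _)]
        set B := (k:ℝ) * (2 * (k:ℝ) ^ 2) ^ k * 2 ^ (18 * k ^ 2) with hB
        have hB0 : 0 ≤ B := by positivity
        calc B = 1 * B := (one_mul _).symm
          _ ≤ (ε / 4 * (k:ℝ) ^ 2) * B := by gcongr
          _ = ε / 4 * ((k:ℝ) ^ 2 * B) := by ring
          _ ≤ ε / 4 * A := by gcongr; exact nb.trans hAk
      linarith
    · -- large p
      push Not at c2
      have hRN : R ≤ (N:ℝ) ^ 2 := by
        rw [hR, div_le_iff₀ hD]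
        rw [div_le_iff₀ (by linarith)] at c1
        rw [inv_le_iff_one_le_mul₀ ha0] at hε
        have e1 : a ≤ a ^ 2 * ε := by nlinarith
        have e2 : a ^ 2 * ε ≤ N * ε := by gcongr
        have e3 : N * ε * 1 ≤ N * ε * (δ * N) := by gcongr
        nlinarith
      have hk2 : (k:ℝ) ^ 2 ≤ 16641 * (N:ℝ) ^ 4 := by
        calc (k:ℝ) ^ 2 ≤ (129 * (N:ℝ) ^ 2) ^ 2 := by
              gcongr; linarith
          _ = _ := by ring
      have hp : 1 / (16641 * (N:ℝ) ^ 4) ≤ p := by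
        rw [div_le_iff₀ (by positivity)]
        nlinarith
      have bp := big_p' hN hg hκ h1 hp
      have : ∀ w : Cube N → Bool, (1:ℝ) ≤ if ∃ T : Finset (Cube N), (∀ x ∈ T, w x = true) ∧
          (T.card : ℝ) ≤ A ∧ 1 - δ ≤ gT p (fE κ) T then (1:ℝ) else 0 := by
        intro w
        rw [if_pos]
        refine ⟨∅, by simp, by simpa using (Real.exp_pos _).le, ?_⟩
        have : gT p (fE κ) (∅ : Finset (Cube N)) = BE p (fE (N := N) κ) := by
          unfold gT
          simp
        rw [this]; linarith
      have q := BE_mono h0.le h1 this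
      have q1 : BE p (fun _ : Cube N → Bool => (1:ℝ)) = 1 := PE_const (fun _ => bw_sum p) 1
      rw [q1] at q
      linarith

/-- For N sufficiently large, any ε_N ∈ [(log log N)^{-1/10}, 1), and any
δ ∈ (0,1): with ℙ_{p*}-probability at least ε_N/2, the set {x : ω_x = 1}
contains a (1-δ)-boosting set at parameter p* of cardinality at most
exp(10^{15} (δ ε_N)^{-2} (log log N)^{1/5}). -/
theorem boosting_set_in_configuration (κ : ℝ) :
    ∃ N₀ : ℕ, ∀ N : ℕ, N₀ ≤ N →
      ∀ εN δ pN : ℝ,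
        Real.log (Real.log N) ^ (-(1 : ℝ) / 10) ≤ εN → εN < 1 →
        0 < δ → δ < 1 →
        0 ≤ pN → pN ≤ 1 →
        bernoulliP pN (emptyInter (N := N) κ) = εN →
        bernoulliP (pStar (N := N) κ pN)
            {ω : Cube N → Bool |
              ∃ T : Finset (Cube N), (∀ x ∈ T, ω x = true) ∧
                (T.card : ℝ) ≤
                  Real.exp (10 ^ 15 * (δ * εN) ^ (-2 : ℝ) *
                    Real.log (Real.log N) ^ ((1 : ℝ) / 5)) ∧
                PerceptronBoosting κ (pStar (N := N) κ pN) δ T} ≥ εN / 2 := by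
  have tl : Filter.Tendsto (fun N : ℕ => Real.log (Real.log N)) Filter.atTop Filter.atTop :=
    Real.tendsto_log_atTop.comp (Real.tendsto_log_atTop.comp tendsto_natCast_atTop_atTop)
  have ev : ∀ᶠ N : ℕ in Filter.atTop, 1 ≤ N ∧ 33282 * (N:ℝ) ^ 5 ≤ 2 ^ (N / 4) ∧ 4 * κ ^ 2 < N ∧
      1 ≤ Real.log (Real.log N) := by
    filter_upwards [growth, Filter.eventually_ge_atTop 1,
      (tendsto_natCast_atTop_atTop (R := ℝ)).eventually (Filter.eventually_gt_atTop (4 * κ ^ 2)),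
      tl.eventually (Filter.eventually_ge_atTop 1)] with N h1 h2 h3 h4
    exact ⟨h2, h1, h3, h4⟩
  obtain ⟨N₀, hN₀⟩ := Filter.eventually_atTop.1 ev
  refine ⟨N₀, fun N hN ε δ pN hε hε1 hδ hδ1 hp0 hp1 hP => ?_⟩
  obtain ⟨n1, hg, hκ, hL⟩ := hN₀ N hN
  set L := Real.log (Real.log N) with hLdef
  have L0 : 0 < L := by linarith
  set a := L ^ ((1:ℝ) / 10) with ha
  have ha1 : 1 ≤ a := Real.one_le_rpow hL (by norm_num)
  have a2 : L ^ ((1:ℝ) / 5) = a ^ 2 := by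
    rw [ha, ← Real.rpow_natCast, ← Real.rpow_mul L0.le]; norm_num
  have ai : L ^ (-(1:ℝ) / 10) = a⁻¹ := by
    rw [ha, ← Real.rpow_neg L0.le]; norm_num
  rw [ai] at hε
  have hε0 : 0 < ε := lt_of_lt_of_le (by positivity) hε
  have haN : a ^ 2 ≤ N := by
    rw [← a2]
    calc L ^ ((1:ℝ) / 5) ≤ L ^ (1:ℝ) := Real.rpow_le_rpow_of_exponent_le hL (by norm_num)
      _ = L := Real.rpow_one L
      _ ≤ Real.log N := Real.log_le_self (Real.log_natCast_nonneg N)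
      _ ≤ N := Real.log_le_self (by positivity)
  obtain ⟨f1, f2, f3, f4⟩ := pStar_facts (κ := κ) L0.le hp0 hp1 hε0 hP
  have c := core n1 hg hκ ha1 haN hε hε1 hδ hδ1 f1 f2 f3 f4
  have eA : 10 ^ 15 * (δ * ε) ^ (-2 : ℝ) * L ^ ((1 : ℝ) / 5) = 10 ^ 15 * (a / (δ * ε)) ^ 2 := by
    rw [a2, Real.rpow_neg (by positivity)]
    have : (δ * ε) ^ (2:ℝ) = (δ * ε) ^ 2 := by exact_mod_cast Real.rpow_natCast (δ * ε) 2
    rw [this, div_pow]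
    ring
  rw [eA, bernoulliP_eq, ge_iff_le]
  refine c.trans (le_of_eq ?_)
  congr 1
  funext w
  unfold indS
  have : (w ∈ {ω : Cube N → Bool |
              ∃ T : Finset (Cube N), (∀ x ∈ T, ω x = true) ∧
                (T.card : ℝ) ≤ Real.exp (10 ^ 15 * (a / (δ * ε)) ^ 2) ∧
                PerceptronBoosting κ (pStar (N := N) κ pN) δ T}) ↔
      ∃ T : Finset (Cube N), (∀ x ∈ T, w x = true) ∧
        (T.card : ℝ) ≤ Real.exp (10 ^ 15 * (a / (δ * ε)) ^ 2) ∧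
        1 - δ ≤ gT (pStar (N := N) κ pN) (fE κ) T := by
    simp only [← boost_iff]
    rfl
  by_cases h : ∃ T : Finset (Cube N), (∀ x ∈ T, w x = true) ∧
        (T.card : ℝ) ≤ Real.exp (10 ^ 15 * (a / (δ * ε)) ^ 2) ∧
        1 - δ ≤ gT (pStar (N := N) κ pN) (fE κ) T
  · rw [if_pos h, if_pos (this.2 h)]
  · rw [if_neg h, if_neg (fun h' => h (this.1 h'))]
end
end

section
/- Let k ≥ 1 and X, Y ∈ Σ_N^k. If |I_a(X)| = |I_a(Y)| for all a ∈ {-1,1}^{k-1}, then there exist a permutation σ ∈ S_N and g ∈ Σ_N such that g∘(σ∘X) = Y. -/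
open scoped Classical

noncomputable section

/-- The sign-switching action of `g ∈ Σ_N` on `x ∈ Σ_N`: `(g∘x)^i = g^i x^i`.
In the boolean encoding the product of signs `g^i x^i` is `+1` iff `g^i = x^i`. -/
def signSwitch {N : ℕ} (g : Cube N) (x : Cube N) : Cube N := fun i => g i == x i

/-- For a tuple `Y = (y_1, …, y_{k+1}) ∈ Σ_N^{k+1}` (a tuple of length `k+1`,
so that the number of vectors is at least one) and a sign pattern
`a ∈ {-1,1}^k`, the set `I_a(Y)` of positions `j ∈ [N]` such that the `j`-th
component of `y_1 ∘ y_{i+1}` equals `a_i` for every `i = 1, …, k`. -/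
def Ia {N k : ℕ} (Y : Fin (k + 1) → Cube N) (a : Fin k → Bool) : Set (Fin N) :=
  {j | ∀ i : Fin k, signSwitch (Y 0) (Y i.succ) j = a i}

/-- The record `φ_I(Y) = (I_a(Y))_{a ∈ {-1,1}^k}`. -/
def phiI {N k : ℕ} (Y : Fin (k + 1) → Cube N) : (Fin k → Bool) → Set (Fin N) :=
  fun a => Ia Y a

/-- The label-exchanging action of `σ ∈ S_N` on `x ∈ Σ_N`:
`(σ∘x)^i = x^{σ^{-1}(i)}`. -/
def permAct {N : ℕ} (σ : Equiv.Perm (Fin N)) (x : Cube N) : Cube N :=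
  fun i => x (σ.symm i)

/-- Let k ≥ 1 (tuples of length `k + 1`) and `X, Y ∈ Σ_N^{k+1}`.
If `|I_a(X)| = |I_a(Y)|` for all sign patterns `a ∈ {-1,1}^k`, then there are
a permutation `σ ∈ S_N` and `g ∈ Σ_N` with `g ∘ (σ ∘ X) = Y` (acting
componentwise). -/
theorem tuple_match_of_Ia_card_eq (N k : ℕ) (X Y : Fin (k + 1) → Cube N)
    (h : ∀ a : Fin k → Bool, (Ia X a).ncard = (Ia Y a).ncard) :
    ∃ σ : Equiv.Perm (Fin N), ∃ g : Cube N,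
      (fun i => signSwitch g (permAct σ (X i))) = Y := by
  let p : (Fin (k + 1) → Cube N) → Fin N → (Fin k → Bool) :=
    fun Z j i => signSwitch (Z 0) (Z i.succ) j
  have hI : ∀ Z a, Ia Z a = {j | p Z j = a} := by
    intro Z a
    ext j
    simp only [Ia, Set.mem_ofPred_eq, p, funext_iff]
  have e : ∀ a, Nonempty ({j // p X j = a} ≃ {j // p Y j = a}) := by
    intro a
    have h1 := h a
    rw [hI, hI] at h1
    exact Finite.card_eq.mp h1
  have e := fun a => (e a).some
  let σ : Equiv.Perm (Fin N) :=
    (Equiv.sigmaFiberEquiv (p X)).symm.trans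
      ((Equiv.sigmaCongrRight e).trans (Equiv.sigmaFiberEquiv (p Y)))
  have hσ : ∀ j, p Y (σ j) = p X j := fun j => (e (p X j) ⟨j, rfl⟩).2
  refine ⟨σ, fun j => Y 0 j == X 0 (σ.symm j), ?_⟩
  funext i j
  have h2 := hσ (σ.symm j)
  rw [Equiv.apply_symm_apply] at h2
  simp only [signSwitch, permAct]
  refine Fin.cases ?_ (fun i => ?_) i
  · cases Y 0 j <;> cases X 0 (σ.symm j) <;> rfl
  · have h3 := congrFun h2 i
    simp only [p, signSwitch] at h3
    revert h3
    cases Y 0 j <;> cases X 0 (σ.symm j) <;> cases Y i.succ j <;>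
      cases X i.succ (σ.symm j) <;> simp
end
end
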